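/- arXiv:1709.01840 — 2 statements merged into one kernel-verified Lean document; each statement's English description precedes it below -/
import Mathlib

section
/- Let H be an infinite-dimensional separable complex Hilbert space and let T be a bounded linear operator on H with property (CN). Then T is normal (T∘T† = T†∘T), and the spectrum σ(T) ⊆ ℂ of T has empty interior and connected complement ℂ \ σ(T). -/
open ContinuousLinearMap

/-- `P` is an orthogonal projection. -/
def IsOrthoProj {H : Type*} [NormedAddCommGroup H] [InnerProductSpace ℂ H]
    [CompleteSpace H] (P : H →L[ℂ] H) : Prop :=
  P * P = P ∧ ContinuousLinearMap.adjoint P = P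

/-- Property (CN): the two off-diagonal corners always have the same norm. -/
def HasCN {H : Type*} [NormedAddCommGroup H] [InnerProductSpace ℂ H]
    [CompleteSpace H] (T : H →L[ℂ] H) : Prop :=
  ∀ P : H →L[ℂ] H, IsOrthoProj P →
    ‖P * T * (1 - P)‖ = ‖(1 - P) * T * P‖

section CornerNorms

variable {H : Type*} [NormedAddCommGroup H] [InnerProductSpace ℂ H] [CompleteSpace H]
variable {F : Type*} [NormedAddCommGroup F] [InnerProductSpace ℂ F] [CompleteSpace F]

theorem HasCN.sub_smul_one {T : H →L[ℂ] H} (hT : HasCN T) (c : ℂ) : HasCN (T - c • 1) := by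
  intro P hP
  have h1 : P * (T - c • 1) * (1 - P) = P * T * (1 - P) := by
    have : P * (c • (1 : H →L[ℂ] H)) * (1 - P) = c • (P - P * P) := by
      simp [mul_sub, smul_sub]
    rw [mul_sub P T, sub_mul, this, hP.1]; simp
  have h2 : (1 - P) * (T - c • 1) * P = (1 - P) * T * P := by
    have : (1 - P) * (c • (1 : H →L[ℂ] H)) * P = c • (P - P * P) := by
      simp [sub_mul, smul_sub]
    rw [mul_sub, sub_mul, this, hP.1]; simp
  rw [h1, h2, hT P hP]

theorem HasCN.smul {T : H →L[ℂ] H} (hT : HasCN T) (c : ℂ) : HasCN (c • T) := by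
  intro P hP
  simp [norm_smul, hT P hP]

theorem HasCN.adjoint {T : H →L[ℂ] H} (hT : HasCN T) : HasCN (ContinuousLinearMap.adjoint T) := by
  intro P hP
  have hP' : star P = P := hP.2
  have h1 : P * ContinuousLinearMap.adjoint T * (1 - P) = star ((1 - P) * T * P) := by
    simp [← star_eq_adjoint, hP', mul_assoc]
  have h2 : (1 - P) * ContinuousLinearMap.adjoint T * P = star (P * T * (1 - P)) := by
    simp [← star_eq_adjoint, hP', mul_assoc]
  rw [h1, h2, norm_star, norm_star, hT P hP]

theorem norm_sub_apply_adjoint_sq {W : F →L[ℂ] H} (hW : ∀ s, ‖W s‖ = ‖s‖) (z : H) :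
    ‖z - W (ContinuousLinearMap.adjoint W z)‖ ^ 2
      = ‖z‖ ^ 2 - ‖ContinuousLinearMap.adjoint W z‖ ^ 2 := by
  have hWW : ∀ s, ContinuousLinearMap.adjoint W (W s) = s := fun s =>
    congrArg (fun f : F →L[ℂ] F => f s) ((norm_map_iff_adjoint_comp_self W).1 hW)
  have h0 : inner ℂ (z - W (ContinuousLinearMap.adjoint W z))
      (W (ContinuousLinearMap.adjoint W z)) = 0 := by
    rw [← ContinuousLinearMap.adjoint_inner_left, map_sub, hWW, sub_self, inner_zero_left]
  have h1 := norm_add_sq_eq_norm_sq_add_norm_sq_of_inner_eq_zero _ _ h0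
  rw [sub_add_cancel, hW] at h1
  linarith [sq ‖z‖, sq ‖ContinuousLinearMap.adjoint W z‖,
    sq ‖z - W (ContinuousLinearMap.adjoint W z)‖]

/-- The compression estimate behind all uses of (CN): the norm of a corner at the range of an
isometry `W` is controlled by the adjoint corner. -/
theorem HasCN.corner_le {T : H →L[ℂ] H} (hT : HasCN T) {W : F →L[ℂ] H}
    (hW : ∀ s, ‖W s‖ = ‖s‖) {κ : ℝ}
    (h : ∀ s, ‖T (W s)‖ ^ 2 - ‖ContinuousLinearMap.adjoint W (T (W s))‖ ^ 2 ≤ κ * ‖s‖ ^ 2) (s : F) :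
    ‖ContinuousLinearMap.adjoint T (W s)‖ ^ 2
      - ‖ContinuousLinearMap.adjoint W (ContinuousLinearMap.adjoint T (W s))‖ ^ 2
      ≤ κ * ‖s‖ ^ 2 := by
  rcases eq_or_ne s 0 with rfl | hs
  · simp
  have hκ : 0 ≤ κ := by
    have h1 := h s
    rw [← norm_sub_apply_adjoint_sq hW] at h1
    have h2 : 0 < ‖s‖ ^ 2 := by positivity
    exact nonneg_of_mul_nonneg_left ((sq_nonneg _).trans h1) h2
  have hWW : ContinuousLinearMap.adjoint W ∘L W = 1 := (norm_map_iff_adjoint_comp_self W).1 hW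
  have hWs : ∀ s, ContinuousLinearMap.adjoint W (W s) = s := fun s =>
    congrArg (fun f : F →L[ℂ] F => f s) hWW
  have hWle : ∀ z, ‖ContinuousLinearMap.adjoint W z‖ ≤ ‖z‖ := fun z => by
    have h1 := norm_sub_apply_adjoint_sq hW z
    refine le_of_sq_le_sq ?_ (norm_nonneg _)
    linarith [sq_nonneg ‖z - W (ContinuousLinearMap.adjoint W z)‖]
  let P : H →L[ℂ] H := W ∘L ContinuousLinearMap.adjoint W
  have hPz : ∀ z, P z = W (ContinuousLinearMap.adjoint W z) := fun _ => rfl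
  have hP : IsOrthoProj P := by
    constructor
    · ext z
      simp [hPz, hWs]
    · simp [P, ContinuousLinearMap.adjoint_comp]
  have hle : ‖(1 - P) * T * P‖ ≤ √κ := by
    refine ContinuousLinearMap.opNorm_le_bound _ (Real.sqrt_nonneg _) fun z => ?_
    have h1 := h (ContinuousLinearMap.adjoint W z)
    rw [← norm_sub_apply_adjoint_sq hW] at h1
    have h2 : ((1 - P) * T * P) z = T (W (ContinuousLinearMap.adjoint W z))
      - W (ContinuousLinearMap.adjoint W (T (W (ContinuousLinearMap.adjoint W z)))) := rfl
    rw [h2]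
    refine le_of_sq_le_sq ?_ (by positivity)
    rw [mul_pow, Real.sq_sqrt hκ]
    exact h1.trans (mul_le_mul_of_nonneg_left (pow_le_pow_left₀ (norm_nonneg _) (hWle z) 2) hκ)
  have hle' : ‖(1 - P) * ContinuousLinearMap.adjoint T * P‖ ≤ √κ := by
    have hP' : star P = P := hP.2
    have h2 : (1 - P) * ContinuousLinearMap.adjoint T * P = star (P * T * (1 - P)) := by
      simp [← star_eq_adjoint, hP', mul_assoc]
    rw [h2, norm_star, hT P hP]
    exact hle
  rw [← norm_sub_apply_adjoint_sq hW]
  have h3 := ((1 - P) * ContinuousLinearMap.adjoint T * P).le_of_opNorm_le hle' (W s)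
  have h4 : ((1 - P) * ContinuousLinearMap.adjoint T * P) (W s) =
      ContinuousLinearMap.adjoint T (W (ContinuousLinearMap.adjoint W (W s)))
      - W (ContinuousLinearMap.adjoint W
        (ContinuousLinearMap.adjoint T (W (ContinuousLinearMap.adjoint W (W s))))) := rfl
  rw [h4, hWs, hW] at h3
  calc _ ≤ (√κ * ‖s‖) ^ 2 := pow_le_pow_left₀ (norm_nonneg _) h3 2
    _ = κ * ‖s‖ ^ 2 := by rw [mul_pow, Real.sq_sqrt hκ]

theorem HasCN.norm_apply_le {T : H →L[ℂ] H} (hT : HasCN T) (x : H) :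
    ‖ContinuousLinearMap.adjoint T x‖ ≤ ‖T x‖ := by
  suffices key : ∀ y : H, ‖y‖ = 1 → ‖ContinuousLinearMap.adjoint T y‖ ≤ ‖T y‖ by
    rcases eq_or_ne x 0 with rfl | hx
    · simp
    have h1 := key ((‖x‖⁻¹ : ℂ) • x) (norm_smul_inv_norm hx)
    rw [map_smul, map_smul, norm_smul, norm_smul] at h1
    refine le_of_mul_le_mul_left h1 ?_
    simpa using hx
  intro y hy
  let W : ℂ →L[ℂ] H := ContinuousLinearMap.toSpanSingleton ℂ y
  have hWs : ∀ s, W s = s • y := fun _ => rfl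
  have hW : ∀ s, ‖W s‖ = ‖s‖ := fun s => by simp [hWs, norm_smul, hy]
  have hWa : ∀ z, ContinuousLinearMap.adjoint W z = inner ℂ y z := fun z => by
    refine ext_inner_left ℂ fun s => ?_
    rw [ContinuousLinearMap.adjoint_inner_right, hWs, inner_smul_left]
    simp [mul_comm]
  have h := hT.corner_le hW (κ := ‖T y‖ ^ 2 - ‖inner ℂ y (T y)‖ ^ 2) (fun s => le_of_eq ?_) 1
  · simp only [hWs, hWa, one_smul, norm_one, one_pow, mul_one] at h
    have h2 : ‖inner ℂ y (ContinuousLinearMap.adjoint T y)‖ = ‖inner ℂ y (T y)‖ := by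
      rw [ContinuousLinearMap.adjoint_inner_right, norm_inner_symm]
    rw [h2] at h
    exact le_of_sq_le_sq (by linarith) (norm_nonneg _)
  · simp only [hWs, hWa, map_smul, norm_smul, inner_smul_right, norm_mul]
    ring

theorem HasCN.isStarNormal {T : H →L[ℂ] H} (hT : HasCN T) : IsStarNormal T := by
  refine isStarNormal_iff_norm_eq_adjoint.2 fun x => le_antisymm ?_ (hT.norm_apply_le x)
  simpa using hT.adjoint.norm_apply_le x

theorem norm_add_smul_sq_add_norm_sub_smul_sq {E : Type*} [NormedAddCommGroup E]
    [InnerProductSpace ℂ E] (x y : E) (a b : ℂ) :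
    ‖a • x + b • y‖ ^ 2 + ‖-(starRingEnd ℂ b) • x + starRingEnd ℂ a • y‖ ^ 2
      = (‖a‖ ^ 2 + ‖b‖ ^ 2) * (‖x‖ ^ 2 + ‖y‖ ^ 2) := by
  rw [@norm_add_sq ℂ, @norm_add_sq ℂ]
  have h : inner ℂ (-(starRingEnd ℂ b) • x) (starRingEnd ℂ a • y) = - inner ℂ (a • x) (b • y) := by
    simp only [inner_smul_left, inner_smul_right, map_neg, Complex.conj_conj]
    ring
  rw [h]
  simp only [norm_smul, norm_neg, RCLike.norm_conj, map_neg]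
  ring

theorem HasCN.exists_adjoint_mem_of_orthonormal {T : H →L[ℂ] H} (hT : HasCN T) {u w : H}
    (hu : ‖u‖ = 1) (hw : ‖w‖ = 1) (huw : inner ℂ u w = 0) {α β : ℂ}
    (hTu : T u = α • u + β • w) :
    ∃ p q p' q' : ℂ, (p ≠ 0 ∨ q ≠ 0) ∧
      ContinuousLinearMap.adjoint T (p • u + q • w) = p' • u + q' • w := by
  let W : EuclideanSpace ℂ (Fin 2) →L[ℂ] H :=
    (EuclideanSpace.proj (0 : Fin 2) : EuclideanSpace ℂ (Fin 2) →L[ℂ] ℂ).smulRight u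
      + (EuclideanSpace.proj (1 : Fin 2) : EuclideanSpace ℂ (Fin 2) →L[ℂ] ℂ).smulRight w
  have hWs : ∀ s, W s = s 0 • u + s 1 • w := fun _ => rfl
  have hW : ∀ s, ‖W s‖ = ‖s‖ := fun s => by
    have h1 : ‖W s‖ ^ 2 = ‖s‖ ^ 2 := by
      rw [hWs, @norm_add_sq ℂ, EuclideanSpace.norm_sq_eq]
      simp [inner_smul_left, inner_smul_right, huw, norm_smul, hu, hw]
    exact (pow_left_inj₀ (norm_nonneg _) (norm_nonneg _) two_ne_zero).1 h1
  have hWa : ∀ z, ContinuousLinearMap.adjoint W z = !₂[inner ℂ u z, inner ℂ w z] := fun z => by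
    refine ext_inner_left ℂ fun s => ?_
    rw [ContinuousLinearMap.adjoint_inner_right, hWs]
    simp [inner_add_left, inner_smul_left, PiLp.inner_apply, mul_comm]
  have hN : ∀ z, ‖z - W (ContinuousLinearMap.adjoint W z)‖ ^ 2
      = ‖z‖ ^ 2 - ‖inner ℂ u z‖ ^ 2 - ‖inner ℂ w z‖ ^ 2 := fun z => by
    rw [norm_sub_apply_adjoint_sq hW, hWa, EuclideanSpace.norm_sq_eq]
    simp
    ring
  let f : EuclideanSpace ℂ (Fin 2) →L[ℂ] H :=
    (1 - W ∘L ContinuousLinearMap.adjoint W) ∘L ContinuousLinearMap.adjoint T ∘L W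
  have hf : ∀ s, f s = ContinuousLinearMap.adjoint T (W s)
    - W (ContinuousLinearMap.adjoint W (ContinuousLinearMap.adjoint T (W s))) := fun _ => rfl
  by_cases hker : ∃ s, s ≠ 0 ∧ f s = 0
  · obtain ⟨s, hs, hfs⟩ := hker
    refine ⟨s 0, s 1, ContinuousLinearMap.adjoint W (ContinuousLinearMap.adjoint T (W s)) 0,
      ContinuousLinearMap.adjoint W (ContinuousLinearMap.adjoint T (W s)) 1, ?_, ?_⟩
    · by_contra! h
      refine hs ?_
      ext i
      fin_cases i
      · exact h.1
      · exact h.2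
    · rw [← hWs, ← hWs]
      exact sub_eq_zero.1 ((hf s).symm.trans hfs)
  push Not at hker
  exfalso
  have hinj : Function.Injective (f : EuclideanSpace ℂ (Fin 2) →ₗ[ℂ] H) := by
    refine (injective_iff_map_eq_zero _).2 fun s hs => ?_
    by_contra h
    exact hker s h hs
  obtain ⟨K, hK0, hK⟩ := (LinearMap.injective_iff_antilipschitz _).1 hinj
  have hK' : ∀ s, ‖s‖ ≤ K * ‖f s‖ := fun s => by
    simpa using hK.le_mul_dist s 0
  have hK0' : (0 : ℝ) < K := hK0
  set e0 : EuclideanSpace ℂ (Fin 2) := !₂[1, 0] with he0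
  set e1 : EuclideanSpace ℂ (Fin 2) := !₂[0, 1] with he1
  have hW0 : W e0 = u := by simp [hWs, he0]
  have hW1 : W e1 = w := by simp [hWs, he1]
  have hpar : ∀ s, ‖f s‖ ^ 2 ≤ (‖f e0‖ ^ 2 + ‖f e1‖ ^ 2 - (K : ℝ)⁻¹ ^ 2) * ‖s‖ ^ 2 := fun s => by
    let s' : EuclideanSpace ℂ (Fin 2) := !₂[-(starRingEnd ℂ (s 1)), starRingEnd ℂ (s 0)]
    have h1 : f s = s 0 • f e0 + s 1 • f e1 := by
      rw [← map_smul, ← map_smul, ← map_add]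
      congr 1
      ext i
      fin_cases i <;> simp [he0, he1]
    have h2 : f s' = -(starRingEnd ℂ (s 1)) • f e0 + starRingEnd ℂ (s 0) • f e1 := by
      rw [← map_smul, ← map_smul, ← map_add]
      congr 1
      ext i
      fin_cases i <;> simp [he0, he1, s']
    have h3 := norm_add_smul_sq_add_norm_sub_smul_sq (f e0) (f e1) (s 0) (s 1)
    rw [← h1, ← h2] at h3
    have h4 : ‖s‖ ^ 2 = ‖s 0‖ ^ 2 + ‖s 1‖ ^ 2 := by
      rw [EuclideanSpace.norm_sq_eq]; simp
    have h5 : ‖s'‖ ^ 2 = ‖s 0‖ ^ 2 + ‖s 1‖ ^ 2 := by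
      rw [EuclideanSpace.norm_sq_eq]; simp [s', add_comm]
    have h6 : (K : ℝ)⁻¹ ^ 2 * ‖s'‖ ^ 2 ≤ ‖f s'‖ ^ 2 := by
      rw [← mul_pow]
      refine pow_le_pow_left₀ (by positivity) ?_ 2
      rw [inv_mul_le_iff₀ hK0']
      exact hK' s'
    rw [h5, ← h4] at h6
    rw [← h4] at h3
    nlinarith
  have hmain := hT.adjoint.corner_le hW
    (κ := ‖f e0‖ ^ 2 + ‖f e1‖ ^ 2 - (K : ℝ)⁻¹ ^ 2)
    (fun s => by rw [← norm_sub_apply_adjoint_sq hW, ← hf]; exact hpar s) e1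
  rw [ContinuousLinearMap.adjoint_adjoint, hW1, ← norm_sub_apply_adjoint_sq hW, hN, hf, hf,
    hW0, hW1, hN, hN] at hmain
  have hn := fun x => isStarNormal_iff_norm_eq_adjoint.1 hT.isStarNormal x
  have hTu0 : ‖T u‖ ^ 2 - ‖inner ℂ u (T u)‖ ^ 2 - ‖inner ℂ w (T u)‖ ^ 2 = 0 := by
    have hwu : inner ℂ w u = 0 := by rw [← inner_conj_symm, huw, map_zero]
    rw [← hN, hWa, hTu]
    simp [hWs, huw, hwu, hu, hw]
  have hin : ∀ x y : H, ‖inner ℂ x (ContinuousLinearMap.adjoint T y)‖ = ‖inner ℂ y (T x)‖ :=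
    fun x y => by rw [ContinuousLinearMap.adjoint_inner_right, norm_inner_symm]
  rw [hin, hin, hin, hin, ← hn, ← hn] at hmain
  have he1n : ‖e1‖ ^ 2 = 1 := by rw [EuclideanSpace.norm_sq_eq]; simp [he1]
  rw [he1n] at hmain
  have : 0 < (K : ℝ)⁻¹ ^ 2 := by positivity
  linarith

/-- The subspace spanned by `u` and `T u` is invariant in one direction up to rank one, so (CN)
forces a linear relation between `u`, `T u`, `T† u` and `T† T u`. -/
theorem HasCN.exists_linear_relation {T : H →L[ℂ] H} (hT : HasCN T) {u : H} (hu : u ≠ 0) :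
    ∃ a b c d : ℂ, (a ≠ 0 ∨ b ≠ 0) ∧
      a • ContinuousLinearMap.adjoint T u + b • ContinuousLinearMap.adjoint T (T u)
        = c • u + d • T u := by
  suffices key : ∀ v : H, ‖v‖ = 1 → ∃ a b c d : ℂ, (a ≠ 0 ∨ b ≠ 0) ∧
      a • ContinuousLinearMap.adjoint T v + b • ContinuousLinearMap.adjoint T (T v)
        = c • v + d • T v by
    obtain ⟨a, b, c, d, hab, h⟩ := key _ (norm_smul_inv_norm (𝕜 := ℂ) hu)
    refine ⟨a, b, c, d, hab, ?_⟩
    have hu' : ((‖u‖ : ℂ)⁻¹) ≠ 0 := by simpa using hu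
    refine smul_right_injective H hu' ?_
    simp only [map_smul] at h
    simp only [smul_add]
    convert h using 2 <;> exact smul_comm _ _ _
  intro v hv
  set α := inner ℂ v (T v)
  by_cases hdep : T v - α • v = 0
  · refine ⟨1, 0, starRingEnd ℂ α, 0, Or.inl one_ne_zero, ?_⟩
    have h1 := (hT.sub_smul_one α).norm_apply_le v
    have h2 : (T - α • (1 : H →L[ℂ] H)) v = T v - α • v := rfl
    rw [h2, hdep, norm_zero, norm_le_zero_iff, map_sub] at h1
    have h3 : ContinuousLinearMap.adjoint (α • (1 : H →L[ℂ] H)) = starRingEnd ℂ α • 1 := by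
      rw [map_smulₛₗ, ← star_eq_adjoint, star_one]
    rw [h3] at h1
    simpa using sub_eq_zero.1 h1
  · set β : ℂ := (‖T v - α • v‖ : ℂ)
    have hβ : β ≠ 0 := by simpa [β] using hdep
    obtain ⟨p, q, p', q', hpq, h⟩ := hT.exists_adjoint_mem_of_orthonormal hv
      (w := β⁻¹ • (T v - α • v)) (norm_smul_inv_norm hdep) (by
        rw [inner_smul_right, inner_sub_right, inner_smul_right, inner_self_eq_norm_sq_to_K, hv]
        simp [α]) (α := α) (β := β) (by rw [smul_inv_smul₀ hβ]; abel)
    refine ⟨p - q * β⁻¹ * α, q * β⁻¹, p' - q' * β⁻¹ * α, q' * β⁻¹, ?_, ?_⟩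
    · by_cases hq : q = 0
      · left; simpa [hq] using hpq
      · right; exact mul_ne_zero hq (inv_ne_zero hβ)
    · rw [← map_smul, ← map_smul, ← map_add]
      rw [show (p - q * β⁻¹ * α) • v + (q * β⁻¹) • T v = p • v + q • β⁻¹ • (T v - α • v) by module,
        h]
      module

end CornerNorms

section SpectralSupport

variable {H : Type*} [NormedAddCommGroup H] [InnerProductSpace ℂ H] [CompleteSpace H]

/-- The vector `v` lies in the spectral subspace of the normal operator `T` attached to the
closed set `s`. -/
def SpectrallySupported (T : H →L[ℂ] H) (s : Set ℂ) (v : H) : Prop :=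
  ∀ f : ℂ → ℂ, Continuous f → (∀ z ∈ s, f z = 0) → cfc f T v = 0

namespace SpectrallySupported

variable {T : H →L[ℂ] H} {s t : Set ℂ} {v w : H}

theorem mono (hv : SpectrallySupported T s v) (hst : s ⊆ t) : SpectrallySupported T t v :=
  fun f hf h => hv f hf fun z hz => h z (hst hz)

theorem smul (hv : SpectrallySupported T s v) (c : ℂ) : SpectrallySupported T s (c • v) :=
  fun f hf h => by rw [map_smul, hv f hf h, smul_zero]

theorem of_hasSum {ι : Type*} {x : ι → H} (hx : HasSum x v)
    (h : ∀ i, SpectrallySupported T s (x i)) : SpectrallySupported T s v := fun f hf hs => by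
  refine (hx.mapL (cfc f T)).unique ?_
  simp only [h _ f hf hs]
  exact hasSum_zero

theorem map_cfc [IsStarNormal T] (hv : SpectrallySupported T s v) (g : ℂ → ℂ) :
    SpectrallySupported T s (cfc g T v) := fun f hf h => by
  have h1 : cfc f T * cfc g T = cfc g T * cfc f T := cfc_commute_cfc f g T
  change (cfc f T * cfc g T) v = 0
  rw [h1, mul_apply_eq_comp, hv f hf h, map_zero]

theorem map [IsStarNormal T] (hv : SpectrallySupported T s v) : SpectrallySupported T s (T v) := by
  have h := hv.map_cfc id
  rwa [cfc_id ℂ T] at h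

theorem inner_eq_zero [IsStarNormal T] (hv : SpectrallySupported T s v)
    (hw : SpectrallySupported T t w) (hs : IsClosed s) (ht : IsClosed t) (hst : Disjoint s t) :
    inner ℂ v w = 0 := by
  obtain ⟨φ, h0, h1, -⟩ := exists_continuous_zero_one_of_isClosed hs ht hst
  have hc : Continuous fun z => (φ z : ℂ) := by fun_prop
  have hv0 : cfc (fun z => (φ z : ℂ)) T v = 0 := hv _ hc fun z hz => by simp [h0 hz]
  have hw0 : w - cfc (fun z => (φ z : ℂ)) T w = 0 := by
    have h2 := hw (fun z => 1 - (φ z : ℂ)) (by fun_prop) fun z hz => by simp [h1 hz]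
    rw [cfc_sub _ _ T, cfc_const_one ℂ T] at h2
    exact h2
  have hsa : adjoint (cfc (fun z => (φ z : ℂ)) T) = cfc (fun z => (φ z : ℂ)) T := by
    rw [← star_eq_adjoint, ← cfc_star]
    simp
  rw [sub_eq_zero.1 hw0, ← adjoint_inner_left, hsa, hv0, inner_zero_left]

theorem norm_sub_le [IsStarNormal T] {c : ℂ} {ε : ℝ} (hε : 0 < ε)
    (hv : SpectrallySupported T (Metric.closedBall c ε) v) : ‖T v - c • v‖ ≤ 2 * ε * ‖v‖ := by
  set g : ℂ → ℂ := fun z => (z - c) * ((max 0 (min 1 (2 - ‖z - c‖ / ε)) : ℝ) : ℂ) with hg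
  have hgc : Continuous g := by fun_prop
  have h1 := hv (fun z => (z - c) - g z) (by fun_prop) fun z hz => by
    have h2 : ‖z - c‖ / ε ≤ 1 := by
      rw [div_le_one hε, ← dist_eq_norm]; exact hz
    have h3 : max 0 (min 1 (2 - ‖z - c‖ / ε)) = 1 := by
      rw [min_eq_left (by linarith), max_eq_right zero_le_one]
    simp [hg, h3]
  rw [cfc_sub _ _ T, cfc_sub _ _ T, cfc_id' ℂ T, cfc_const c T] at h1
  have h4 : T v - c • v = cfc g T v := by
    have : T v - c • v - cfc g T v = 0 := by
      simpa [Algebra.algebraMap_eq_smul_one] using h1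
    exact sub_eq_zero.1 this
  rw [h4]
  refine le_of_opNorm_le _ (norm_cfc_le (by positivity) fun z _ => ?_) v
  have h5 : |max 0 (min 1 (2 - ‖z - c‖ / ε))| = max 0 (min 1 (2 - ‖z - c‖ / ε)) :=
    abs_of_nonneg (le_max_left _ _)
  rw [hg, norm_mul, Complex.norm_real, Real.norm_eq_abs, h5]
  by_cases h6 : ‖z - c‖ ≤ 2 * ε
  · calc _ ≤ ‖z - c‖ * 1 := by
          gcongr
          exact max_le zero_le_one (min_le_left _ _)
      _ ≤ _ := by simpa using h6
  · have h7 : 2 - ‖z - c‖ / ε ≤ 0 := by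
      rw [sub_nonpos, le_div_iff₀ hε]; linarith
    rw [max_eq_left ((min_le_right _ _).trans h7), mul_zero]
    positivity

end SpectrallySupported

theorem exists_spectrallySupported {T : H →L[ℂ] H} [IsStarNormal T] {c : ℂ}
    (hc : c ∈ spectrum ℂ T) {ε : ℝ} (hε : 0 < ε) :
    ∃ v, ‖v‖ = 1 ∧ SpectrallySupported T (Metric.closedBall c ε) v := by
  set ψ : ℂ → ℂ := fun z => ((max 0 (ε - ‖z - c‖) : ℝ) : ℂ) with hψ
  have hψc : Continuous ψ := by fun_prop
  have hne : cfc ψ T ≠ 0 := fun h => by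
    have h1 : ψ c ∈ spectrum ℂ (cfc ψ T) := by
      rw [cfc_map_spectrum ψ T]
      exact ⟨c, hc, rfl⟩
    have : Nontrivial H := by
      by_contra hH
      rw [not_nontrivial_iff_subsingleton] at hH
      simp [spectrum.of_subsingleton] at hc
    rw [h, spectrum.zero_eq] at h1
    simp [hψ, max_eq_right hε.le, hε.ne'] at h1
  obtain ⟨x, hx⟩ : ∃ x, cfc ψ T x ≠ 0 := by
    by_contra! h
    exact hne (ext h)
  refine ⟨_, norm_smul_inv_norm (𝕜 := ℂ) hx, SpectrallySupported.smul (fun f hf hfs => ?_) _⟩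
  change (cfc f T * cfc ψ T) x = 0
  rw [← cfc_mul f ψ T, show (fun z => f z * ψ z) = fun _ => 0 from ?_, cfc_const_zero ℂ T]
  · rfl
  · funext z
    by_cases hz : z ∈ Metric.closedBall c ε
    · simp [hfs z hz]
    · have : ε - ‖z - c‖ ≤ 0 := by
        rw [mem_closedBall_iff_norm, not_le] at hz
        linarith
      simp [hψ, max_eq_left this]

end SpectralSupport

theorem isConnected_compl_of_subset_frontier {X : Type*} [TopologicalSpace X] {A B C K : Set X}
    (hA : IsPreconnected A) (hB : IsPreconnected B) (hAC : C ⊆ closure A) (hBC : C ⊆ closure B)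
    (hcover : ∀ z, z ∈ A ∨ z ∈ B ∨ z ∈ C) (hKA : Disjoint K A) (hKB : Disjoint K B)
    (hCK : (C \ K).Nonempty) : IsConnected Kᶜ := by
  obtain ⟨w, hw⟩ := hCK
  have key : ∀ D : Set X, IsPreconnected D → C ⊆ closure D → IsPreconnected (D ∪ C \ K) :=
    fun D hD hDC => hD.subset_closure Set.subset_union_left
      (Set.union_subset subset_closure (Set.sdiff_subset.trans hDC))
  have hU : Kᶜ = (A ∪ C \ K) ∪ (B ∪ C \ K) := by
    ext z
    have h1 : z ∈ K → z ∉ A := fun h => Set.disjoint_left.1 hKA h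
    have h2 : z ∈ K → z ∉ B := fun h => Set.disjoint_left.1 hKB h
    have h3 := hcover z
    simp only [Set.mem_compl_iff, Set.mem_union, Set.mem_sdiff]
    tauto
  rw [hU]
  exact ⟨⟨w, Or.inl (Or.inr hw)⟩,
    (key A hA hAC).union w (Or.inr hw) (Or.inr hw) (key B hB hBC)⟩

theorem isPreconnected_compl_closedBall (o : ℂ) {r : ℝ} (hr : 0 ≤ r) :
    IsPreconnected {z : ℂ | r < ‖z - o‖} := by
  have hS : IsPreconnected (Metric.sphere (0 : ℂ) 1) :=
    isPreconnected_sphere (by simp) 0 1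
  have h := (isPreconnected_Ioi (a := r)).prod hS
  convert h.image (fun p : ℝ × ℂ => o + p.1 * p.2) (by fun_prop) using 1
  ext z
  simp only [Set.mem_ofPred_eq, Set.mem_image, Set.mem_prod, Set.mem_Ioi, mem_sphere_zero_iff_norm,
    Prod.exists]
  constructor
  · intro hz
    have h0 : ‖z - o‖ ≠ 0 := (hr.trans_lt hz).ne'
    refine ⟨‖z - o‖, (z - o) / ‖z - o‖, ⟨hz, ?_⟩, ?_⟩
    · rw [norm_div, Complex.norm_real, norm_norm, div_self h0]
    · have : (‖z - o‖ : ℂ) ≠ 0 := by exact_mod_cast h0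
      rw [mul_div_cancel₀ _ this]; ring
  · rintro ⟨t, s, ⟨ht, hs⟩, rfl⟩
    have : 0 < t := hr.trans_lt ht
    simpa [hs, abs_of_pos this] using ht

theorem isConnected_compl_of_subset_sphere {K : Set ℂ} {o : ℂ} {r : ℝ} (hr : 0 < r)
    (hK : K ⊆ Metric.sphere o r) (hne : ¬ Metric.sphere o r ⊆ K) : IsConnected Kᶜ := by
  obtain ⟨w, hw, hwK⟩ := Set.not_subset.1 hne
  have hext : {z : ℂ | r < ‖z - o‖} = (Metric.closedBall o r)ᶜ := by
    ext z; simp [dist_eq_norm]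
  refine isConnected_compl_of_subset_frontier (A := Metric.ball o r) (B := {z : ℂ | r < ‖z - o‖})
    (C := Metric.sphere o r) (convex_ball o r).isPreconnected
    (isPreconnected_compl_closedBall o hr.le) ?_ ?_ ?_ ?_ ?_ ⟨w, hw, hwK⟩
  · rw [closure_ball o hr.ne']
    exact Metric.sphere_subset_closedBall
  · rw [hext, closure_compl, interior_closedBall o hr.ne']
    intro z hz
    simp only [Metric.mem_sphere] at hz
    simp [hz]
  · intro z
    simp only [Metric.mem_ball, Set.mem_ofPred_eq, Metric.mem_sphere, dist_eq_norm]
    rcases lt_trichotomy ‖z - o‖ r with h | h | h <;> simp [h]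
  · refine Set.disjoint_left.2 fun z hz h => ?_
    have := hK hz
    simp only [Metric.mem_sphere, Metric.mem_ball] at this h
    linarith
  · refine Set.disjoint_left.2 fun z hz h => ?_
    have := hK hz
    simp only [Metric.mem_sphere, Set.mem_ofPred_eq, dist_eq_norm] at this h
    linarith

theorem isConnected_compl_of_subset_line {K : Set ℂ} (hb : Bornology.IsBounded K) {a d : ℂ}
    (hd : d ≠ 0) (hK : ∀ z ∈ K, ((z - a) / d).im = 0) : IsConnected Kᶜ := by
  let f : ℂ → ℝ := fun z => ((z - a) / d).im
  let e : ℂ → ℂ := fun z => a + z * d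
  have hfe : ∀ z, f (e z) = z.im := fun z => by simp [f, e, hd]
  have hef : ∀ z, e ((z - a) / d) = z := fun z => by simp only [e]; field_simp; ring
  have he : Continuous e := by fun_prop
  have hAim : {z | 0 < f z} = e '' {z | 0 < z.im} := by
    ext z
    constructor
    · intro h; exact ⟨_, h, hef z⟩
    · rintro ⟨w, hw, rfl⟩; simpa [hfe] using hw
  have hBim : {z | f z < 0} = e '' {z | z.im < 0} := by
    ext z
    constructor
    · intro h; exact ⟨_, h, hef z⟩
    · rintro ⟨w, hw, rfl⟩; simpa [hfe] using hw
  obtain ⟨R, hR⟩ := hb.subset_closedBall a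
  have hclA : closure {z : ℂ | 0 < z.im} = {z | 0 ≤ z.im} := Complex.closure_setOfPred_lt_im 0
  have hclB : closure {z : ℂ | z.im < 0} = {z | z.im ≤ 0} := Complex.closure_setOfPred_im_lt 0
  refine isConnected_compl_of_subset_frontier (A := {z | 0 < f z}) (B := {z | f z < 0})
    (C := {z | f z = 0}) ?_ ?_ ?_ ?_ ?_ ?_ ?_ ?_
  · rw [hAim]
    exact (convex_halfSpace_im_gt 0).isPreconnected.image _ he.continuousOn
  · rw [hBim]
    exact (convex_halfSpace_im_lt 0).isPreconnected.image _ he.continuousOn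
  · intro z hz
    rw [hAim, ← hef z]
    refine image_closure_subset_closure_image he ⟨_, ?_, rfl⟩
    rw [hclA]
    exact (show f z = 0 from hz).ge
  · intro z hz
    rw [hBim, ← hef z]
    refine image_closure_subset_closure_image he ⟨_, ?_, rfl⟩
    rw [hclB]
    exact (show f z = 0 from hz).le
  · intro z
    simp only [Set.mem_ofPred_eq]
    rcases lt_trichotomy (f z) 0 with h | h | h <;> simp [h]
  · exact Set.disjoint_left.2 fun z hz h => (h : 0 < f z).ne' (hK z hz)
  · exact Set.disjoint_left.2 fun z hz h => (h : f z < 0).ne (hK z hz)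
  · have hd' : 0 < ‖d‖ := norm_pos_iff.2 hd
    refine ⟨e (((|R| + 1) / ‖d‖ : ℝ) : ℂ), ?_, fun h => ?_⟩
    · simp only [Set.mem_ofPred_eq, hfe, Complex.ofReal_im]
    · have := hR h
      have h0 : 0 ≤ (|R| + 1) / ‖d‖ := by positivity
      simp only [e, Metric.mem_closedBall, dist_eq_norm, add_sub_cancel_left, norm_mul,
        Complex.norm_real, Real.norm_eq_abs, abs_of_nonneg h0] at this
      rw [div_mul_cancel₀ _ hd'.ne'] at this
      linarith [le_abs_self R]

open ComplexConjugate in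
/-- The determinant of the rows `(z̄, z̄ z, 1, z)`; it vanishes exactly when the four points lie
on a common line or circle. -/
noncomputable def cocircularDet (z : Fin 4 → ℂ) : ℂ :=
  (Matrix.of fun i => ![conj (z i), conj (z i) * z i, 1, z i]).det

open ComplexConjugate in
theorem cocircularDet_eq (a b c z : ℂ) :
    cocircularDet ![a, b, c, z] =
      (a - b) * (c - z) * conj ((a - c) * (b - z))
      - conj ((a - b) * (c - z)) * ((a - c) * (b - z)) := by
  simp [cocircularDet, Matrix.det_succ_row_zero, Fin.sum_univ_succ, Matrix.submatrix, Fin.succAbove]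
  ring

open ComplexConjugate in
theorem interior_eq_empty_of_cocircularDet {K : Set ℂ}
    (hK : ∀ z : Fin 4 → ℂ, (∀ i, z i ∈ K) → cocircularDet z = 0) : interior K = ∅ := by
  by_contra hne
  obtain ⟨z, hz⟩ := Set.nonempty_iff_ne_empty.2 hne
  obtain ⟨ρ, hρ, hball⟩ := Metric.mem_nhds_iff.1 (mem_interior_iff_mem_nhds.1 hz)
  have hmem : ∀ w : ℂ, ‖w‖ < ρ → z + w ∈ K := fun w hw => hball (by simpa using hw)
  have h := hK ![z, z + (ρ / 4 : ℝ), z + (ρ / 2 : ℝ), z + (ρ / 4 : ℝ) * Complex.I] ?_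
  · rw [cocircularDet_eq] at h
    simp only [map_mul, map_sub, map_add, Complex.conj_ofReal, Complex.conj_I] at h
    have h' : ((ρ : ℂ) ^ 4) * Complex.I = 0 := by
      push_cast at h
      linear_combination (64 : ℂ) * h
    simp [hρ.ne'] at h'
  · intro i
    fin_cases i
    · simpa using hmem 0 (by simpa using hρ)
    · exact hmem _ (by rw [Complex.norm_real, Real.norm_eq_abs, abs_lt]; constructor <;> linarith)
    · exact hmem _ (by rw [Complex.norm_real, Real.norm_eq_abs, abs_lt]; constructor <;> linarith)
    · refine hmem _ ?_
      rw [norm_mul, Complex.norm_I, Complex.norm_real, Real.norm_eq_abs, mul_one, abs_lt]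
      constructor <;> linarith

open ComplexConjugate in
theorem exists_circumcenter {a b c : ℂ}
    (h : conj a * (b - c) + conj b * (c - a) + conj c * (a - b) ≠ 0) :
    ∃ o : ℂ, ∀ z, cocircularDet ![a, b, c, z] = 0 → ‖z - o‖ = ‖a - o‖ := by
  set D := conj a * (b - c) + conj b * (c - a) + conj c * (a - b) with hD
  have hD' : conj D = - D := by simp [hD]; ring
  refine ⟨(conj a * a * (b - c) + conj b * b * (c - a) + conj c * c * (a - b)) / D,
    fun z hz => ?_⟩
  set o := (conj a * a * (b - c) + conj b * b * (c - a) + conj c * c * (a - b)) / D with ho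
  have h1 : o * D = conj a * a * (b - c) + conj b * b * (c - a) + conj c * c * (a - b) := by
    rw [ho]; field_simp
  have h2 : conj o * D =
      -(a * conj a * (conj b - conj c) + b * conj b * (conj c - conj a)
        + c * conj c * (conj a - conj b)) := by
    have := congrArg conj h1
    simp only [map_mul, map_add, map_sub, hD', Complex.conj_conj] at this
    linear_combination -this
  have key : (conj z - conj o) * (z - o) = (conj a - conj o) * (a - o) := by
    refine mul_left_cancel₀ h ?_
    rw [cocircularDet_eq] at hz
    simp only [map_mul, map_sub] at hz
    linear_combination -hz + (conj a - conj z) * h1 + (a - z) * h2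
  rw [← map_sub, ← map_sub, ← Complex.normSq_eq_conj_mul_self,
    ← Complex.normSq_eq_conj_mul_self] at key
  have key' : Complex.normSq (z - o) = Complex.normSq (a - o) := by exact_mod_cast key
  rw [Complex.normSq_eq_norm_sq, Complex.normSq_eq_norm_sq] at key'
  exact (pow_left_inj₀ (norm_nonneg _) (norm_nonneg _) two_ne_zero).1 key'

open ComplexConjugate in
theorem isConnected_compl_or_eq_sphere {K : Set ℂ} (hb : Bornology.IsBounded K)
    (hK : ∀ z : Fin 4 → ℂ, (∀ i, z i ∈ K) → cocircularDet z = 0) :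
    IsConnected Kᶜ ∨ ∃ o : ℂ, ∃ r : ℝ, 0 < r ∧ K = Metric.sphere o r := by
  by_cases hs : K.Subsingleton
  · exact Or.inl (hs.countable.isConnected_compl_of_one_lt_rank (by simp))
  obtain ⟨a, ha, b, hb', hab⟩ := Set.not_subsingleton_iff.1 hs
  by_cases hline : ∀ z ∈ K, ((z - a) / (b - a)).im = 0
  · exact Or.inl (isConnected_compl_of_subset_line hb (sub_ne_zero.2 hab.symm) hline)
  push Not at hline
  obtain ⟨c, hc, hcim⟩ := hline
  have hba : b - a ≠ 0 := sub_ne_zero.2 hab.symm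
  have hba' : conj b - conj a ≠ 0 := by rwa [← map_sub, map_ne_zero]
  have hD : conj a * (b - c) + conj b * (c - a) + conj c * (a - b) ≠ 0 := by
    intro h
    refine hcim (Complex.conj_eq_iff_im.1 ?_)
    rw [map_div₀, map_sub, map_sub, div_eq_div_iff hba' hba]
    linear_combination -h
  obtain ⟨o, ho⟩ := exists_circumcenter hD
  have hsub : K ⊆ Metric.sphere o ‖a - o‖ := by
    intro z hz
    rw [mem_sphere_iff_norm]
    exact ho z (hK _ (by intro i; fin_cases i <;> simpa))
  have hr : 0 < ‖a - o‖ := by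
    refine norm_pos_iff.2 fun h => hab ?_
    have := hsub hb'
    rw [mem_sphere_iff_norm, h, norm_zero, norm_eq_zero] at this
    exact sub_left_inj.1 (h.trans this.symm)
  by_cases hne : Metric.sphere o ‖a - o‖ ⊆ K
  · exact Or.inr ⟨o, _, hr, hsub.antisymm hne⟩
  · exact Or.inl (isConnected_compl_of_subset_sphere hr hsub hne)

section Cocircular

variable {H : Type*} [NormedAddCommGroup H] [InnerProductSpace ℂ H] [CompleteSpace H]

theorem HasCN.det_eq_zero_of_spectrallySupported {T : H →L[ℂ] H} (hT : HasCN T)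
    {s : Fin 4 → Set ℂ} (hs : ∀ i, IsClosed (s i)) (hd : Pairwise fun i j => Disjoint (s i) (s j))
    {u : Fin 4 → H} (hu : ∀ i, ‖u i‖ = 1) (hus : ∀ i, SpectrallySupported T (s i) (u i)) :
    (Matrix.of fun i => ![starRingEnd ℂ (inner ℂ (u i) (T (u i))), (‖T (u i)‖ ^ 2 : ℂ), 1,
      inner ℂ (u i) (T (u i))]).det = 0 := by
  have := hT.isStarNormal
  have horth : ∀ i j, i ≠ j → inner ℂ (u i) (u j) = 0 := fun i j h =>
    (hus i).inner_eq_zero (hus j) (hs i) (hs j) (hd h)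
  have horth' : ∀ i j, i ≠ j → inner ℂ (u i) (T (u j)) = 0 := fun i j h =>
    (hus i).inner_eq_zero (hus j).map (hs i) (hs j) (hd h)
  have horthA : ∀ i j, i ≠ j → inner ℂ (T (u i)) (u j) = 0 := fun i j h =>
    (hus i).map.inner_eq_zero (hus j) (hs i) (hs j) (hd h)
  have horth2 : ∀ i j, i ≠ j → inner ℂ (T (u i)) (T (u j)) = 0 := fun i j h =>
    (hus i).map.inner_eq_zero (hus j).map (hs i) (hs j) (hd h)
  have hself : ∀ i, inner ℂ (u i) (u i) = (1 : ℂ) := fun i => by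
    rw [inner_self_eq_norm_sq_to_K, hu]; simp
  have hsum : ∑ i, u i ≠ 0 := fun h => by
    have h1 : inner ℂ (u 0) (∑ i, u i) = (1 : ℂ) := by
      rw [inner_sum, Finset.sum_eq_single 0 (fun j _ hj => horth _ _ hj.symm) (by simp), hself]
    rw [h, inner_zero_right] at h1
    exact zero_ne_one h1
  obtain ⟨a, b, c, d, hab, h⟩ := hT.exists_linear_relation hsum
  refine Matrix.exists_mulVec_eq_zero_iff.1 ⟨![a, b, -c, -d], fun h0 => ?_, ?_⟩
  · have ha : a = 0 := congrFun h0 0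
    have hb : b = 0 := congrFun h0 1
    simp [ha, hb] at hab
  · funext k
    have h1 := congrArg (inner ℂ (u k)) h
    simp only [inner_add_right, inner_smul_right, adjoint_inner_right] at h1
    simp only [map_sum, inner_sum] at h1
    rw [Finset.sum_eq_single k (fun j _ hj => horthA _ _ hj.symm) (by simp),
      Finset.sum_eq_single k (fun j _ hj => horth2 _ _ hj.symm) (by simp),
      Finset.sum_eq_single k (fun j _ hj => horth _ _ hj.symm) (by simp),
      Finset.sum_eq_single k (fun j _ hj => horth' _ _ hj.symm) (by simp), hself,
      inner_self_eq_norm_sq_to_K, ← inner_conj_symm] at h1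
    simp only [Matrix.mulVec, dotProduct, Fin.sum_univ_four, Matrix.of_apply, Matrix.cons_val,
      Pi.zero_apply]
    simp only [Complex.coe_algebraMap] at h1
    linear_combination h1

theorem HasCN.cocircularDet_eq_zero {T : H →L[ℂ] H} (hT : HasCN T) {z : Fin 4 → ℂ}
    (hz : ∀ i, z i ∈ spectrum ℂ T) : cocircularDet z = 0 := by
  have := hT.isStarNormal
  by_cases hinj : Function.Injective z
  swap
  · simp only [Function.Injective, not_forall] at hinj
    obtain ⟨i, j, hij, hne⟩ := hinj
    refine Matrix.det_zero_of_row_eq hne ?_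
    funext k
    simp [hij]
  obtain ⟨δ, hδ, hdisj⟩ : ∃ δ > 0, ∀ i j, i ≠ j → 2 * δ < dist (z i) (z j) := by
    obtain ⟨p, hp⟩ := Finite.exists_min
      fun p : Fin 4 × Fin 4 => if p.1 = p.2 then 1 else dist (z p.1) (z p.2)
    set m := if p.1 = p.2 then 1 else dist (z p.1) (z p.2) with hm
    have hm0 : 0 < m := by
      rw [hm]
      split_ifs with h
      · exact one_pos
      · exact dist_pos.2 (hinj.ne h)
    refine ⟨m / 3, by positivity, fun i j h => ?_⟩
    have := hp (i, j)
    simp only [h, if_false] at this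
    linarith
  let ε : ℕ → ℝ := fun n => δ / (n + 1)
  have hε : ∀ n, 0 < ε n := fun n => by positivity
  have hεδ : ∀ n, ε n ≤ δ := fun n => div_le_self hδ.le (by simp)
  have hε0 : Filter.Tendsto ε Filter.atTop (nhds 0) := by
    simpa [ε, div_eq_mul_inv] using
      (tendsto_one_div_add_atTop_nhds_zero_nat (𝕜 := ℝ)).const_mul δ
  choose u hu hus using fun n i => exists_spectrallySupported (hz i) (hε n)
  have hbd : ∀ n i, ‖T (u n i) - z i • u n i‖ ≤ 2 * ε n := fun n i => by
    simpa [hu] using (hus n i).norm_sub_le (hε n)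
  have hlim : ∀ i, Filter.Tendsto (fun n => T (u n i) - z i • u n i) Filter.atTop (nhds 0) :=
    fun i => squeeze_zero_norm (fun n => hbd n i) (by simpa using hε0.const_mul 2)
  have hm : ∀ i, Filter.Tendsto (fun n => inner ℂ (u n i) (T (u n i))) Filter.atTop
      (nhds (z i)) := fun i => by
    rw [tendsto_iff_norm_sub_tendsto_zero]
    refine squeeze_zero_norm (fun n => ?_) (by simpa using hε0.const_mul 2)
    have : inner ℂ (u n i) (T (u n i)) - z i = inner ℂ (u n i) (T (u n i) - z i • u n i) := by
      rw [inner_sub_right, inner_smul_right, inner_self_eq_norm_sq_to_K, hu]; simp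
    rw [norm_norm, this]
    refine (norm_inner_le_norm _ _).trans ?_
    rw [hu, one_mul]
    exact hbd n i
  have hn : ∀ i, Filter.Tendsto (fun n => ‖T (u n i)‖) Filter.atTop (nhds ‖z i‖) := fun i => by
    rw [tendsto_iff_norm_sub_tendsto_zero]
    refine squeeze_zero_norm (fun n => ?_) (by simpa using hε0.const_mul 2)
    have : ‖z i‖ = ‖z i • u n i‖ := by rw [norm_smul, hu, mul_one]
    rw [norm_norm, this, Real.norm_eq_abs]
    exact (abs_norm_sub_norm_le _ _).trans (hbd n i)
  have hdet : ∀ n, (Matrix.of fun i => ![starRingEnd ℂ (inner ℂ (u n i) (T (u n i))),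
      (‖T (u n i)‖ ^ 2 : ℂ), 1, inner ℂ (u n i) (T (u n i))]).det = 0 := fun n =>
    hT.det_eq_zero_of_spectrallySupported (fun i => Metric.isClosed_closedBall)
      (fun i j h => Metric.closedBall_disjoint_closedBall
        (by linarith [hdisj i j h, hεδ n])) (hu n) (hus n)
  have hconv : Filter.Tendsto (fun n => (Matrix.of fun i =>
      ![starRingEnd ℂ (inner ℂ (u n i) (T (u n i))),
      (‖T (u n i)‖ ^ 2 : ℂ), 1, inner ℂ (u n i) (T (u n i))]).det) Filter.atTop
      (nhds (cocircularDet z)) := by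
    refine ((continuous_id.matrix_det).tendsto _).comp ?_
    refine tendsto_pi_nhds.2 fun i => tendsto_pi_nhds.2 fun j => ?_
    fin_cases j
    · exact (Complex.continuous_conj.tendsto _).comp (hm i)
    · have h1 : (starRingEnd ℂ (z i) * z i) = (‖z i‖ ^ 2 : ℂ) := by
        rw [mul_comm, Complex.mul_conj, Complex.normSq_eq_norm_sq]; simp
      change Filter.Tendsto (fun n => (‖T (u n i)‖ ^ 2 : ℂ)) _ (nhds (starRingEnd ℂ (z i) * z i))
      rw [h1]
      exact ((Complex.continuous_ofReal.tendsto _).comp (hn i)).pow 2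
    · exact tendsto_const_nhds
    · exact hm i
  refine tendsto_nhds_unique hconv ?_
  simp only [hdet]
  exact tendsto_const_nhds

end Cocircular

section Circle

variable {H : Type*} [NormedAddCommGroup H] [InnerProductSpace ℂ H] [CompleteSpace H]
variable {F : Type*} [NormedAddCommGroup F] [InnerProductSpace ℂ F] [CompleteSpace F]

/-- An isometry with four mutually orthogonal almost-eigenspaces, for the fourth roots of unity,
has a compression close to half of a non-unitary isometry `S`; (CN) rules this out. -/
theorem HasCN.false_of_isometry {U : H →L[ℂ] H} (hU : HasCN U) (hn : ∀ x, ‖U x‖ = ‖x‖)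
    {X : Fin 4 → F →ₗᵢ[ℂ] H} (hX : OrthogonalFamily ℂ (fun _ => F) X)
    (h : ∀ j s, ‖U (X j s) - (![1, Complex.I, -1, -Complex.I] : Fin 4 → ℂ) j • X j s‖
      ≤ 1 / 32 * ‖s‖)
    (S : F →ₗᵢ[ℂ] F) {e : F} (he : ‖e‖ = 1) (hSe : ∀ s, inner ℂ (S s) e = 0) : False := by
  set ω : Fin 4 → ℂ := ![1, Complex.I, -1, -Complex.I] with hω
  set β : Fin 4 → ℂ := ![1, -Complex.I, -1, Complex.I] with hβ
  set γ : ℂ := (1 + Complex.I) / 4 with hγ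
  have hγγ : starRingEnd ℂ γ * γ = 1 / 8 := by
    simp only [hγ, map_div₀, map_add, map_one, Complex.conj_I, map_ofNat]
    linear_combination (-1 / 16 : ℂ) * Complex.I_sq
  have hγn : ‖γ‖ ≤ 1 / 2 := by
    rw [hγ, norm_div]
    have h1 : ‖(1 : ℂ) + Complex.I‖ ≤ 2 := (norm_add_le _ _).trans (by norm_num)
    have h2 : ‖(4 : ℂ)‖ = 4 := by simp
    rw [h2]
    linarith
  clear_value γ
  let B : Fin 4 → F →L[ℂ] F := fun j => γ • (1 + β j • S.toContinuousLinearMap)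
  have hB : ∀ j s, B j s = γ • (s + β j • S s) := fun _ _ => rfl
  have hBn : ∀ j s, ‖B j s‖ ≤ ‖s‖ := fun j s => by
    have h1 : ‖β j‖ = 1 := by fin_cases j <;> simp [hβ]
    have h2 : ‖s + β j • S s‖ ≤ 2 * ‖s‖ := by
      refine (norm_add_le _ _).trans ?_
      rw [norm_smul, h1, S.norm_map]
      linarith
    rw [hB, norm_smul]
    calc ‖γ‖ * ‖s + β j • S s‖ ≤ 1 / 2 * (2 * ‖s‖) := by gcongr
      _ = ‖s‖ := by ring
  let W : F →L[ℂ] H := ∑ j, (X j).toContinuousLinearMap ∘L B j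
  have hWs : ∀ s, W s = ∑ j, X j (B j s) := fun s => by simp [W]
  have hinner : ∀ s t, inner ℂ (W t) (W s) = inner ℂ t s := fun s t => by
    rw [hWs, hWs, hX.inner_sum]
    simp only [hB, inner_smul_left, inner_smul_right, inner_add_left, inner_add_right,
      S.inner_map_map, Fin.sum_univ_four]
    simp only [hβ, Matrix.cons_val, map_neg, map_one, Complex.conj_I]
    linear_combination (6 * inner ℂ t s - 2 * Complex.I ^ 2 * inner ℂ t s) * hγγ
      - 1 / 4 * inner ℂ t s * Complex.I_sq
  have hW : ∀ s, ‖W s‖ = ‖s‖ := (LinearMap.norm_map_iff_inner_map_map W).2 fun s t => hinner t s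
  have hinner' : ∀ s t, inner ℂ (W t) (∑ j, ω j • X j (B j s)) =
      1 / 2 * inner ℂ t (S s) := fun s t => by
    have h1 : ∀ j, ω j • X j (B j s) = X j (ω j • B j s) := fun j => ((X j).map_smul _ _).symm
    simp only [h1]
    rw [hWs, hX.inner_sum]
    simp only [hB, inner_smul_left, inner_smul_right, inner_add_left, inner_add_right,
      S.inner_map_map, Fin.sum_univ_four]
    simp only [hβ, hω, Matrix.cons_val, map_neg, map_one, Complex.conj_I]
    linear_combination ((2 - 2 * Complex.I ^ 2) * inner ℂ t (S s)
      + (2 + 2 * Complex.I ^ 2) * inner ℂ (S t) s) * hγγ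
      + 1 / 4 * (inner ℂ (S t) s - inner ℂ t (S s)) * Complex.I_sq
  have hcomp : ∀ s, ContinuousLinearMap.adjoint W (∑ j, ω j • X j (B j s)) = (1 / 2 : ℂ) • S s :=
    fun s => ext_inner_left ℂ fun t => by rw [adjoint_inner_right, hinner', inner_smul_right]
  have hWle : ∀ z, ‖ContinuousLinearMap.adjoint W z‖ ≤ ‖z‖ := fun z => by
    have h1 := norm_sub_apply_adjoint_sq hW z
    refine le_of_sq_le_sq ?_ (norm_nonneg _)
    linarith [sq_nonneg ‖z - W (ContinuousLinearMap.adjoint W z)‖]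
  have herr : ∀ s, ‖ContinuousLinearMap.adjoint W (U (W s)) - (1 / 2 : ℂ) • S s‖ ≤ 1 / 8 * ‖s‖ :=
      fun s => by
    rw [← hcomp, ← map_sub]
    refine (hWle _).trans ?_
    rw [hWs, map_sum, ← Finset.sum_sub_distrib]
    refine (norm_sum_le _ _).trans ?_
    calc _ ≤ ∑ _j : Fin 4, 1 / 32 * ‖s‖ := Finset.sum_le_sum fun j _ =>
          (h j _).trans (by gcongr; exact hBn j s)
      _ = 1 / 8 * ‖s‖ := by simp; ring
  have hhalf : ∀ s, ‖(1 / 2 : ℂ) • S s‖ = 1 / 2 * ‖s‖ := fun s => by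
    rw [norm_smul, S.norm_map]; simp
  have hmain := hU.corner_le hW (κ := 1 - (3 / 8) ^ 2) (fun s => by
    have h1 : 3 / 8 * ‖s‖ ≤ ‖ContinuousLinearMap.adjoint W (U (W s))‖ := by
      have h2 := norm_sub_norm_le ((1 / 2 : ℂ) • S s) (ContinuousLinearMap.adjoint W (U (W s)))
      rw [norm_sub_rev, hhalf] at h2
      linarith [herr s]
    have h3 := pow_le_pow_left₀ (by positivity) h1 2
    rw [hn, hW]
    linarith [mul_pow (3 / 8) ‖s‖ 2]) e
  have hUe : ‖ContinuousLinearMap.adjoint U (W e)‖ = 1 := by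
    rw [← isStarNormal_iff_norm_eq_adjoint.1 hU.isStarNormal, hn, hW, he]
  have hsmall : ‖ContinuousLinearMap.adjoint W (ContinuousLinearMap.adjoint U (W e))‖ ≤ 1 / 8 := by
    set y := ContinuousLinearMap.adjoint W (ContinuousLinearMap.adjoint U (W e))
    have h1 : inner ℂ y y
        = inner ℂ e (ContinuousLinearMap.adjoint W (U (W y)) - (1 / 2 : ℂ) • S y) := by
      rw [inner_sub_right, inner_smul_right, ← inner_conj_symm e (S y), hSe, map_zero, mul_zero,
        sub_zero, adjoint_inner_left, adjoint_inner_left, ← adjoint_inner_right W]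
    have h2 : ‖y‖ ^ 2 ≤ 1 / 8 * ‖y‖ := by
      rw [inner_self_eq_norm_sq_to_K] at h1
      have h3 := norm_inner_le_norm (𝕜 := ℂ) e
        (ContinuousLinearMap.adjoint W (U (W y)) - (1 / 2 : ℂ) • S y)
      rw [← h1, he, one_mul] at h3
      simpa using h3.trans (herr y)
    by_contra! h4
    nlinarith
  rw [hUe, he] at hmain
  have := pow_le_pow_left₀ (norm_nonneg _) hsmall 2
  norm_num at hmain this
  linarith

theorem exists_orthonormal_spectrallySupported {T : H →L[ℂ] H} [IsStarNormal T] {c : ℂ} {ε : ℝ}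
    (hinf : (spectrum ℂ T ∩ Metric.ball c ε).Infinite) :
    ∃ x : ℕ → H, Orthonormal ℂ x ∧
      ∀ n, SpectrallySupported T (Metric.closedBall c ε) (x n) := by
  have := hinf.to_subtype
  obtain ⟨V, hVinf, hVo, hVd⟩ :=
    exists_seq_infinite_isOpen_pairwise_disjoint ↥(spectrum ℂ T ∩ Metric.ball c ε)
  choose z hz using fun n => (hVinf n).nonempty
  choose δ hδ hball using fun n => Metric.isOpen_iff.1 (hVo n) (z n) (hz n)
  have hρ : ∀ n, 0 < min (δ n / 3) (ε - dist (z n : ℂ) c) := fun n =>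
    lt_min (by linarith [hδ n]) (sub_pos.2 (z n).2.2)
  have hdist : ∀ n m, n ≠ m → δ n ≤ dist (z n : ℂ) (z m) := fun n m hnm => by
    by_contra! h
    refine Set.disjoint_left.1 (hVd hnm) (hball n ?_) (hz m)
    rw [Metric.mem_ball, dist_comm]
    exact h
  choose x hx hxs using fun n => exists_spectrallySupported (z n).2.1 (hρ n)
  refine ⟨x, ⟨hx, fun n m hnm => ?_⟩, fun n => (hxs n).mono ?_⟩
  · refine (hxs n).inner_eq_zero (hxs m) Metric.isClosed_closedBall Metric.isClosed_closedBall
      (Metric.closedBall_disjoint_closedBall ?_)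
    have h1 := hdist n m hnm
    have h2 := hdist m n hnm.symm
    rw [dist_comm] at h2
    linarith [min_le_left (δ n / 3) (ε - dist (z n : ℂ) c),
      min_le_left (δ m / 3) (ε - dist (z m : ℂ) c), hδ n, hδ m]
  · refine Metric.closedBall_subset_closedBall' ?_
    linarith [min_le_right (δ n / 3) (ε - dist (z n : ℂ) c)]

/-- The isometry of `ℓ²` onto the closed span of an orthonormal sequence. -/
theorem Orthonormal.exists_linearIsometry {x : ℕ → H} (hx : Orthonormal ℂ x) :
    ∃ X : lp (fun _ : ℕ => ℂ) 2 →ₗᵢ[ℂ] H, ∀ s, HasSum (fun n => s n • x n) (X s) :=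
  ⟨hx.orthogonalFamily.linearIsometry, fun s => by
    simpa using hx.orthogonalFamily.hasSum_linearIsometry s⟩

theorem exists_linearIsometry_spectrallySupported {T : H →L[ℂ] H} [IsStarNormal T] {c : ℂ} {ε : ℝ}
    (hinf : (spectrum ℂ T ∩ Metric.ball c ε).Infinite) :
    ∃ X : lp (fun _ : ℕ => ℂ) 2 →ₗᵢ[ℂ] H,
      ∀ s, SpectrallySupported T (Metric.closedBall c ε) (X s) := by
  obtain ⟨x, hx, hxs⟩ := exists_orthonormal_spectrallySupported hinf
  obtain ⟨X, hX⟩ := hx.exists_linearIsometry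
  exact ⟨X, fun s => .of_hasSum (hX s) fun n => (hxs n).smul _⟩

theorem exists_unilateral_shift :
    ∃ (S : lp (fun _ : ℕ => ℂ) 2 →ₗᵢ[ℂ] lp (fun _ : ℕ => ℂ) 2) (e : lp (fun _ : ℕ => ℂ) 2),
      ‖e‖ = 1 ∧ ∀ s, inner ℂ (S s) e = 0 := by
  let b : HilbertBasis ℕ ℂ (lp (fun _ : ℕ => ℂ) 2) := .ofRepr (.refl ℂ _)
  obtain ⟨S, hS⟩ :=
    (b.orthonormal.comp Nat.succ Nat.succ_injective).exists_linearIsometry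
  refine ⟨S, b 0, b.orthonormal.1 0, fun s => ?_⟩
  rw [← inner_conj_symm, map_eq_zero]
  refine ((hS s).mapL (innerSL ℂ (b 0))).unique ?_
  have : ∀ n, inner ℂ (b 0) (b (n + 1)) = 0 := fun n => b.orthonormal.2 (Nat.succ_ne_zero n).symm
  simp [this]

theorem infinite_sphere_inter_ball {o c : ℂ} {r ε : ℝ} (hr : 0 < r) (hc : c ∈ Metric.sphere o r)
    (hε : 0 < ε) : (Metric.sphere o r ∩ Metric.ball c ε).Infinite := by
  have hnt : (Metric.sphere o r).Nontrivial := by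
    refine ⟨o + r, by simp [hr.le], o - r, by simp [hr.le], fun h => hr.ne' ?_⟩
    have : (r : ℂ) = 0 := by linear_combination h / 2
    exact_mod_cast this
  have h1 : AccPt c (Filter.principal (Metric.sphere o r)) :=
    (isPreconnected_sphere (by rw [Complex.rank_real_complex]; norm_num)
      o r).preperfect_of_nontrivial hnt c hc
  have h2 := h1.nhds_inter (Metric.ball_mem_nhds c hε)
  rw [Set.inter_comm]
  exact Set.Infinite.of_accPt h2

theorem HasCN.spectrum_ne_sphere {T : H →L[ℂ] H} (hT : HasCN T) {o : ℂ} {r : ℝ} (hr : 0 < r) :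
    spectrum ℂ T ≠ Metric.sphere o r := fun hsp => by
  have := hT.isStarNormal
  set ω : Fin 4 → ℂ := ![1, Complex.I, -1, -Complex.I] with hω
  have hωn : ∀ j, ‖ω j‖ = 1 := fun j => by fin_cases j <;> simp [hω]
  have hωd : ∀ i j, i ≠ j → 1 ≤ ‖ω i - ω j‖ := fun i j hij => by
    refine le_of_sq_le_sq ?_ (norm_nonneg _)
    rw [← Complex.normSq_eq_norm_sq]
    fin_cases i <;> fin_cases j <;> simp [hω, Complex.normSq_apply] at hij ⊢ <;> norm_num
  have hrc : (r : ℂ) ≠ 0 := by exact_mod_cast hr.ne'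
  set U : H →L[ℂ] H := (r : ℂ)⁻¹ • (T - o • 1) with hU
  have hUs : ∀ x, U x = (r : ℂ)⁻¹ • (T x - o • x) := fun _ => rfl
  have hUn : ∀ x, ‖U x‖ = ‖x‖ := by
    rw [ContinuousLinearMap.norm_map_iff_adjoint_comp_self]
    have hUc : U = cfc (fun z => (r : ℂ)⁻¹ * (z - o)) T := by
      rw [cfc_const_mul _ _ T, cfc_sub _ _ T, cfc_id' ℂ T, cfc_const o T,
        Algebra.algebraMap_eq_smul_one]
    change star U * U = 1
    rw [hUc, ← cfc_star, ← cfc_mul _ _ T, ← cfc_one ℂ T]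
    refine cfc_congr fun z hz => ?_
    rw [hsp, mem_sphere_iff_norm] at hz
    simp only [star_mul', Pi.one_apply]
    have h1 : star (z - o) * (z - o) = (r : ℂ) ^ 2 := by
      rw [← hz]; exact Complex.conj_mul' _
    have h2 : star (r : ℂ)⁻¹ = (r : ℂ)⁻¹ := by simp
    rw [h2]
    calc _ = (r : ℂ)⁻¹ * (r : ℂ)⁻¹ * (star (z - o) * (z - o)) := by ring
      _ = 1 := by rw [h1]; field_simp
  have hmem : ∀ j, o + r * ω j ∈ Metric.sphere o r := fun j => by simp [hωn, hr.le]
  choose X hX using fun j => exists_linearIsometry_spectrallySupported (T := T)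
    (c := o + r * ω j) (ε := r / 64)
    (by rw [hsp]; exact infinite_sphere_inter_ball hr (hmem j) (by positivity))
  have hfam : OrthogonalFamily ℂ (fun _ => lp (fun _ : ℕ => ℂ) 2) X := fun i j hij s t => by
    refine (hX i s).inner_eq_zero (hX j t) Metric.isClosed_closedBall Metric.isClosed_closedBall
      (Metric.closedBall_disjoint_closedBall ?_)
    have h1 : dist (o + r * ω i) (o + r * ω j) = r * ‖ω i - ω j‖ := by
      rw [dist_eq_norm, add_sub_add_left_eq_sub, ← mul_sub, norm_mul]
      simp [abs_of_pos hr]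
    rw [h1]
    nlinarith [hωd i j hij]
  obtain ⟨S, e, he, hSe⟩ := exists_unilateral_shift
  refine ((hT.sub_smul_one o).smul (r : ℂ)⁻¹).false_of_isometry hUn hfam (fun j s => ?_) S he hSe
  have h1 := (hX j s).norm_sub_le (by positivity)
  rw [(X j).norm_map] at h1
  have h2 : U (X j s) - ω j • X j s = (r : ℂ)⁻¹ • (T (X j s) - (o + r * ω j) • X j s) := by
    rw [hUs, add_smul, mul_smul, ← sub_sub, smul_sub (r : ℂ)⁻¹ (T (X j s) - _),
      inv_smul_smul₀ hrc]
  change ‖U (X j s) - ω j • X j s‖ ≤ _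
  rw [h2, norm_smul, norm_inv, Complex.norm_real, Real.norm_of_nonneg hr.le,
    inv_mul_le_iff₀ hr]
  linarith

end Circle

theorem stmt10 {H : Type*} [NormedAddCommGroup H] [InnerProductSpace ℂ H]
    [CompleteSpace H] [TopologicalSpace.SeparableSpace H]
    (hinf : ¬ FiniteDimensional ℂ H)
    (T : H →L[ℂ] H) (hT : HasCN T) :
    T * ContinuousLinearMap.adjoint T = ContinuousLinearMap.adjoint T * T ∧
    interior (spectrum ℂ T) = ∅ ∧ IsConnected (spectrum ℂ T)ᶜ := by
  have hdet : ∀ z : Fin 4 → ℂ, (∀ i, z i ∈ spectrum ℂ T) → cocircularDet z = 0 :=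
    fun _ => hT.cocircularDet_eq_zero
  refine ⟨hT.isStarNormal.star_comm_self.eq.symm,
    interior_eq_empty_of_cocircularDet hdet, ?_⟩
  rcases isConnected_compl_or_eq_sphere (spectrum.isBounded T) hdet with h | ⟨o, r, hr, h⟩
  · exact h
  · exact absurd h (hT.spectrum_ne_sphere hr)
end

section
/- Let H be an infinite-dimensional separable complex Hilbert space and let T be a bounded linear operator on H with property (CR). Suppose there exist α, β, γ, δ ∈ ℂ with δ ≠ 0 such that the operator α·1 + β·T + γ·T† + δ·(T†∘T) has rank at most 3. Then there exist a unitary operator V on H, a bounded operator L on H of rank at most 12, and λ, μ ∈ ℂ such that T = λ·(V + L) + μ·1. -/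
open ContinuousLinearMap

/-- Property (CR): the two off-diagonal corners always have the same rank
(as a cardinal, the dimension of the range). -/
def HasCR {H : Type*} [NormedAddCommGroup H] [InnerProductSpace ℂ H]
    [CompleteSpace H] (T : H →L[ℂ] H) : Prop :=
  ∀ P : H →L[ℂ] H, IsOrthoProj P →
    LinearMap.rank ((P * T * (1 - P) : H →L[ℂ] H) : H →ₗ[ℂ] H) =
    LinearMap.rank (((1 - P) * T * P : H →L[ℂ] H) : H →ₗ[ℂ] H)

open scoped ComplexConjugate

section Rank

universe u

variable {V W W' : Type u} [AddCommGroup V] [Module ℂ V] [AddCommGroup W] [Module ℂ W]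
  [AddCommGroup W'] [Module ℂ W']

theorem LinearMap.rank_le_rank_of_ker_le {f : V →ₗ[ℂ] W} {g : V →ₗ[ℂ] W'}
    (h : g.ker ≤ f.ker) : f.rank ≤ g.rank := by
  unfold LinearMap.rank
  rw [← f.quotKerEquivRange.rank_eq, ← g.quotKerEquivRange.rank_eq]
  exact LinearMap.rank_le_of_surjective _ (Submodule.factor_surjective h)

theorem LinearMap.rank_prod_le (f : V →ₗ[ℂ] W) (g : V →ₗ[ℂ] W') :
    (f.prod g).rank ≤ f.rank + g.rank := by
  have h : f.prod g = LinearMap.inl ℂ W W' ∘ₗ f + LinearMap.inr ℂ W W' ∘ₗ g := by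
    ext x <;> simp
  rw [h]
  exact (LinearMap.rank_add_le _ _).trans
    (add_le_add (LinearMap.rank_comp_le_right _ _) (LinearMap.rank_comp_le_right _ _))

theorem LinearMap.exists_ne_zero_of_rank_lt_aleph0 (hinf : ¬ FiniteDimensional ℂ V)
    {f : V →ₗ[ℂ] W} (hf : f.rank < Cardinal.aleph0) : ∃ x, x ≠ 0 ∧ f x = 0 := by
  by_contra! h
  refine hinf (Module.rank_lt_aleph0_iff.1 ?_)
  have hid : (LinearMap.id : V →ₗ[ℂ] V).rank ≤ f.rank :=
    LinearMap.rank_le_rank_of_ker_le fun x hx => by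
      by_contra hne
      exact h x (by simpa using hne) hx
  rw [LinearMap.rank, LinearMap.range_id, rank_top] at hid
  exact hid.trans_lt hf

/-- An injective finite-rank perturbation of the identity is surjective. -/
theorem LinearMap.surjective_one_add_of_injective {f : V →ₗ[ℂ] V}
    (hf : f.rank < Cardinal.aleph0) (hinj : Function.Injective fun x => x + f x) :
    Function.Surjective fun x => x + f x := by
  intro y
  have : FiniteDimensional ℂ f.range := Module.rank_lt_aleph0_iff.1 hf
  let g : f.range →ₗ[ℂ] f.range := (LinearMap.id + f).restrict
    (fun x hx => add_mem hx (LinearMap.mem_range_self f x))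
  have hg : Function.Injective g := fun a b hab =>
    Subtype.ext (hinj (congrArg Subtype.val hab))
  obtain ⟨m, hm⟩ := LinearMap.injective_iff_surjective.1 hg ⟨f y, LinearMap.mem_range_self f y⟩
  have hm' : (m : V) + f m = f y := congrArg Subtype.val hm
  refine ⟨y - m, ?_⟩
  simp only [map_sub]
  rw [← hm']
  abel

end Rank

theorem mul_units_inv_mem_unitary {R : Type*} [Ring R] [StarRing R] {G : R} (hG : IsUnit G)
    {u : Rˣ} (hu : star (u : R) = u) (h : (u : R) * u = star G * G) :
    G * ↑u⁻¹ ∈ unitary R := by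
  have hinv : star (↑u⁻¹ : R) * u = 1 := by
    conv_lhs => rw [← hu]
    rw [← star_mul, Units.mul_inv, star_one]
  have hV : star (G * ↑u⁻¹) * (G * ↑u⁻¹) = 1 := by
    rw [star_mul, mul_assoc, ← mul_assoc (star G), ← h, mul_assoc, Units.mul_inv, mul_one, hinv]
  refine Unitary.mem_iff.2 ⟨hV, ?_⟩
  rw [← (hG.mul (Units.isUnit u⁻¹)).mul_left_inj, mul_assoc, hV, mul_one, one_mul]

section InnerProduct

universe u

variable {H : Type u} [NormedAddCommGroup H] [InnerProductSpace ℂ H]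

/-- The span of `v` is invariant under `S` exactly when the corresponding corner vanishes. -/
theorem corner_span_eq_zero_iff (S : H →L[ℂ] H) (v : H) :
    (1 - (ℂ ∙ v).starProjection) * S * (ℂ ∙ v).starProjection = 0 ↔ S v ∈ ℂ ∙ v := by
  have hv : (ℂ ∙ v).starProjection v = v :=
    Submodule.starProjection_eq_self_iff.2 (Submodule.mem_span_singleton_self v)
  constructor
  · intro h
    have h' := DFunLike.congr_fun h v
    simp only [mul_apply_eq_comp, sub_apply, one_apply_eq_self, zero_apply, hv, sub_eq_zero] at h'
    exact Submodule.starProjection_eq_self_iff.1 h'.symm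
  · intro h
    ext x
    obtain ⟨c, hc⟩ := Submodule.mem_span_singleton.1
      (Submodule.starProjection_apply_mem (ℂ ∙ v) x)
    simp only [mul_apply_eq_comp, sub_apply, one_apply_eq_self, zero_apply]
    rw [← hc, map_smul, map_smul, Submodule.starProjection_eq_self_iff.2 h, sub_self]

theorem ContinuousLinearMap.rank_eq_zero_iff {A : H →L[ℂ] H} :
    (A : H →ₗ[ℂ] H).rank = 0 ↔ A = 0 := by
  rw [LinearMap.rank, Submodule.rank_eq_zero, LinearMap.range_eq_bot]
  exact ⟨fun h => ContinuousLinearMap.coe_injective h, fun h => by rw [h]; rfl⟩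

/-- A positive operator fixes every vector that its square fixes. -/
theorem apply_eq_self_of_apply_apply_eq_self {R : H →L[ℂ] H} (hR : R.IsPositive) {x : H}
    (hx : R (R x) = x) : R x = x := by
  have hRy : R (R x - x) = -(R x - x) := by rw [map_sub, hx]; abel
  have hpos := hR.re_inner_nonneg_right (R x - x)
  rw [hRy, inner_neg_right, map_neg, inner_self_eq_norm_sq] at hpos
  rw [← sub_eq_zero, ← norm_eq_zero]
  nlinarith [sq_nonneg ‖R x - x‖]

/-- If `T` is affine in a unitary on the kernel of an operator of rank at most `n`, then it is
affine in a rank-`n` perturbation of that unitary. -/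
theorem exists_eq_smul_add_of_ker {W : Type u} [AddCommGroup W] [Module ℂ W] {T V : H →L[ℂ] H}
    {l m : ℂ} (hl : l ≠ 0) {Φ : H →ₗ[ℂ] W} (h : ∀ x, Φ x = 0 → T x = l • V x + m • x) :
    ∃ L : H →L[ℂ] H, (L : H →ₗ[ℂ] H).rank ≤ Φ.rank ∧ T = l • (V + L) + m • 1 := by
  refine ⟨l⁻¹ • (T - m • 1) - V, LinearMap.rank_le_rank_of_ker_le fun x hx => ?_, ?_⟩
  · simp [h x hx, hl]
  · rw [add_sub_cancel, smul_inv_smul₀ hl, sub_add_cancel]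

end InnerProduct

section Operators

variable {H : Type*} [NormedAddCommGroup H] [InnerProductSpace ℂ H] [CompleteSpace H]

theorem ContinuousLinearMap.rank_adjoint_le {F : H →L[ℂ] H}
    (hF : (F : H →ₗ[ℂ] H).rank < Cardinal.aleph0) :
    (adjoint F : H →ₗ[ℂ] H).rank ≤ (F : H →ₗ[ℂ] H).rank := by
  have : FiniteDimensional ℂ (F : H →ₗ[ℂ] H).range := Module.rank_lt_aleph0_iff.1 hF
  have h : (adjoint F : H →ₗ[ℂ] H).rank ≤
      ((F : H →ₗ[ℂ] H).range.starProjection : H →ₗ[ℂ] H).rank := by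
    refine LinearMap.rank_le_rank_of_ker_le fun x hx => ?_
    rw [Submodule.ker_starProjection] at hx
    refine ext_inner_left ℂ fun y => ?_
    rw [inner_zero_right, ContinuousLinearMap.coe_coe, adjoint_inner_right]
    exact hx _ (LinearMap.mem_range_self _ y)
  refine h.trans_eq ?_
  rw [LinearMap.rank, Submodule.range_starProjection, LinearMap.rank]

theorem isOrthoProj_starProjection (U : Submodule ℂ H) [U.HasOrthogonalProjection] :
    IsOrthoProj U.starProjection :=
  ⟨isStarProjection_starProjection.isIdempotentElem, isStarProjection_starProjection.isSelfAdjoint⟩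

theorem HasCR.mem_span_iff {T : H →L[ℂ] H} (hT : HasCR T) (v : H) :
    T v ∈ ℂ ∙ v ↔ adjoint T v ∈ ℂ ∙ v := by
  have hP := isOrthoProj_starProjection (ℂ ∙ v)
  rw [← corner_span_eq_zero_iff, ← corner_span_eq_zero_iff,
    ← ContinuousLinearMap.rank_eq_zero_iff, ← hT _ hP,
    ContinuousLinearMap.rank_eq_zero_iff, ← star_eq_zero, star_mul, star_mul, star_sub, star_one]
  simp only [star_eq_adjoint, hP.2, mul_assoc]

theorem HasCR.apply_eq_smul_iff {T : H →L[ℂ] H} (hT : HasCR T) (v : H) (c : ℂ) :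
    T v = c • v ↔ adjoint T v = conj c • v := by
  rcases eq_or_ne v 0 with rfl | hv
  · simp
  have hvv : inner ℂ v v ≠ 0 := inner_self_ne_zero.2 hv
  constructor
  · intro h
    obtain ⟨d, hd⟩ := Submodule.mem_span_singleton.1 ((hT.mem_span_iff v).1
      (Submodule.mem_span_singleton.2 ⟨c, h.symm⟩))
    have h1 := adjoint_inner_right T v v
    rw [← hd, h, inner_smul_right, inner_smul_left] at h1
    rw [← hd, mul_right_cancel₀ hvv h1]
  · intro h
    obtain ⟨d, hd⟩ := Submodule.mem_span_singleton.1 ((hT.mem_span_iff v).2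
      (Submodule.mem_span_singleton.2 ⟨_, h.symm⟩))
    have h1 := adjoint_inner_right T v v
    rw [← hd, h, inner_smul_right, inner_smul_left] at h1
    rw [← hd, (starRingEnd ℂ).injective (mul_right_cancel₀ hvv h1)]

/-- The absolute value of an invertible operator, as a unit. -/
theorem exists_units_mul_self_eq {G : H →L[ℂ] H} (hG : IsUnit G) :
    ∃ u : (H →L[ℂ] H)ˣ, (u : H →L[ℂ] H) * u = star G * G ∧ (u : H →L[ℂ] H).IsPositive := by
  have hA : 0 ≤ star G * G := star_mul_self_nonneg G
  obtain ⟨u, hu⟩ := (CFC.isUnit_sqrt_iff (star G * G) hA).2 (hG.star.mul hG)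
  refine ⟨u, ?_, ?_⟩
  · rw [hu]
    exact CFC.sqrt_mul_sqrt_self (star G * G) hA
  · rw [hu, ← nonneg_iff_isPositive]
    exact CFC.sqrt_nonneg _

/-- The unitary part in the polar decomposition of an invertible operator `G`; it agrees with `G`
wherever `G` acts as a partial isometry. -/
theorem exists_unitary_of_isUnit {G : H →L[ℂ] H} (hG : IsUnit G) :
    ∃ V : H →L[ℂ] H, adjoint V * V = 1 ∧ V * adjoint V = 1 ∧
      ∀ x, adjoint G (G x) = x → V x = G x := by
  obtain ⟨u, hRR, hpos⟩ := exists_units_mul_self_eq hG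
  have hV := mul_units_inv_mem_unitary hG hpos.isSelfAdjoint hRR
  refine ⟨G * ↑u⁻¹, by rw [← star_eq_adjoint, Unitary.star_mul_self_of_mem hV],
    by rw [← star_eq_adjoint, Unitary.mul_star_self_of_mem hV], fun x hx => ?_⟩
  have hux : (u : H →L[ℂ] H) x = x := by
    refine apply_eq_self_of_apply_apply_eq_self hpos ?_
    rw [← mul_apply_eq_comp, hRR]
    exact hx
  have hix : (↑u⁻¹ : H →L[ℂ] H) x = x := by
    conv_lhs => rw [← hux]
    rw [← mul_apply_eq_comp, Units.inv_mul, one_apply_eq_self]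
  rw [mul_apply_eq_comp, hix]

theorem injective_add_starProjection {S : H →L[ℂ] H} {N : Submodule ℂ H}
    [N.HasOrthogonalProjection] (h₁ : ∀ v, S v = 0 → v ∈ N) (h₂ : ∀ v ∈ N, adjoint S v = 0) :
    Function.Injective (S + N.starProjection) := by
  rw [injective_iff_map_eq_zero]
  intro x hx
  have hx' : N.starProjection x = -S x := eq_neg_of_add_eq_zero_right hx
  have hP : N.starProjection x = 0 := by
    rw [← inner_self_eq_zero (𝕜 := ℂ)]
    nth_rewrite 2 [hx']
    rw [inner_neg_right, ← adjoint_inner_left, h₂ _ (N.starProjection_apply_mem x),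
      inner_zero_left, neg_zero]
  have hS : S x = 0 := by rw [← neg_eq_zero, ← hx', hP]
  rw [← hP, Submodule.starProjection_eq_self_iff.2 (h₁ x hS)]

/-- An operator that is isometric up to finite rank and has the same kernel as its adjoint agrees
with a unitary off a finite-dimensional subspace. -/
theorem exists_unitary_of_adjoint_mul_self_eq {S F : H →L[ℂ] H}
    (hS : adjoint S * S = 1 + F) (hF : (F : H →ₗ[ℂ] H).rank < Cardinal.aleph0)
    (hker : ∀ v, S v = 0 ↔ adjoint S v = 0) :
    ∃ V : H →L[ℂ] H, adjoint V * V = 1 ∧ V * adjoint V = 1 ∧ ∀ x, F x = 0 → V x = S x := by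
  set N : Submodule ℂ H := (S : H →ₗ[ℂ] H).ker with hN
  have hmem : ∀ v, v ∈ N ↔ S v = 0 := fun v => Iff.rfl
  have : CompleteSpace N := (ContinuousLinearMap.isClosed_ker S).completeSpace_coe
  set P := N.starProjection with hP
  have hPP := isOrthoProj_starProjection N
  have hSx : ∀ x, adjoint S (S x) = x + F x := fun x => DFunLike.congr_fun hS x
  have hNF : N ≤ (F : H →ₗ[ℂ] H).range := fun x hx => by
    refine ⟨-x, ?_⟩
    have h := hSx x
    rw [(hmem x).1 hx, map_zero] at h
    rw [map_neg, ContinuousLinearMap.coe_coe]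
    exact (eq_neg_of_add_eq_zero_left h.symm).symm
  have hPrank : (P : H →ₗ[ℂ] H).rank < Cardinal.aleph0 := by
    rw [LinearMap.rank, hP, Submodule.range_starProjection]
    exact (Submodule.rank_mono hNF).trans_lt hF
  have hSP : ∀ x, S (P x) = 0 := fun x => (hmem _).1 (N.starProjection_apply_mem x)
  have hSaP : ∀ x, adjoint S (P x) = 0 := fun x => (hker _).1 (hSP x)
  have hadj : adjoint (S + P) = adjoint S + P := by rw [map_add, hPP.2]
  have hPS : ∀ x, P (S x) = 0 := fun x => by
    refine ext_inner_left ℂ fun y => ?_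
    rw [← adjoint_inner_left, hPP.2, ← adjoint_inner_left, hSaP, inner_zero_left, inner_zero_right]
  have hGG : ∀ x, adjoint (S + P) ((S + P) x) = x + (F + P) x := fun x => by
    have hPPx : P (P x) = P x := DFunLike.congr_fun hPP.1 x
    rw [hadj]
    simp only [add_apply, map_add, hSx, hSaP, hPS, hPPx]
    abel
  have hGinj : Function.Injective (S + P) :=
    injective_add_starProjection (fun v hv => hv) fun v hv => (hker v).1 hv
  have hGainj : Function.Injective (adjoint (S + P)) := by
    rw [hadj]
    refine injective_add_starProjection (fun v hv => (hker v).2 hv) fun v hv => ?_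
    rw [adjoint_adjoint]
    exact hv
  have hsurj : Function.Surjective fun x => x + ((F + P : H →L[ℂ] H) : H →ₗ[ℂ] H) x := by
    refine LinearMap.surjective_one_add_of_injective ?_ ?_
    · exact (LinearMap.rank_add_le _ _).trans_lt (Cardinal.add_lt_aleph0 hF hPrank)
    · intro x y hxy
      apply hGinj
      apply hGainj
      rw [hGG, hGG]
      exact hxy
  have hG : IsUnit (S + P) := by
    refine ContinuousLinearMap.isUnit_iff_bijective.2 ⟨hGinj, fun y => ?_⟩
    obtain ⟨x, hx⟩ := hsurj (adjoint (S + P) y)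
    exact ⟨x, hGainj ((hGG x).trans hx)⟩
  obtain ⟨V, h1, h2, h3⟩ := exists_unitary_of_isUnit hG
  refine ⟨V, h1, h2, fun x hx => ?_⟩
  have hxP : P x = 0 := by
    rw [hP, Submodule.starProjection_apply_eq_zero_iff]
    intro y hy
    have h := hSx x
    rw [hx, add_zero] at h
    rw [← h, adjoint_inner_right, (hmem y).1 hy, inner_zero_left]
  have := h3 x (by rw [hGG, add_apply, hx, hxP, add_zero, add_zero])
  rw [this, add_apply, hxP, add_zero]

/-- A self-adjoint operator is affine in a single unitary on the kernel of a quadratic polynomial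
in it. -/
theorem exists_unitary_of_quadratic {A : H →L[ℂ] H} (hA : adjoint A = A) (a b : ℂ) :
    ∃ (V : H →L[ℂ] H) (l m : ℂ), l ≠ 0 ∧ adjoint V * V = 1 ∧ V * adjoint V = 1 ∧
      ∀ x, A (A x) = (a + b) • A x - (a * b) • x → A x = l • V x + m • x := by
  have hsymm : ∀ x y, inner ℂ (A x) y = inner ℂ x (A y) := fun x y => by
    rw [← adjoint_inner_left, hA]
  have horth : ∀ {s t : ℂ} {x y : H}, s ≠ t → A x = s • x → A y = t • y → inner ℂ x y = 0 := by
    intro s t x y hst hx hy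
    have hs : LinearMap.IsSymmetric (A : H →ₗ[ℂ] H) := hsymm
    exact hs.orthogonalFamily_eigenspaces hst ⟨x, Module.End.mem_eigenspace_iff.2 hx⟩
      ⟨y, Module.End.mem_eigenspace_iff.2 hy⟩
  rcases eq_or_ne a b with rfl | hab
  · refine ⟨1, 1, a - 1, one_ne_zero, ?_, ?_, fun x hx => ?_⟩
    · rw [← star_eq_adjoint, star_one, one_mul]
    · rw [← star_eq_adjoint, star_one, one_mul]
    · set y := A x - a • x with hy
      have hAy : A y = a • y := by
        rw [hy, map_sub, map_smul, hx]
        module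
      have hyy : y = 0 := by
        by_contra hne
        have hyy : inner ℂ y y ≠ 0 := inner_self_ne_zero.2 hne
        have hreal := hsymm y y
        rw [hAy, inner_smul_left, inner_smul_right] at hreal
        have hconj : conj a = a := mul_right_cancel₀ hyy hreal
        apply hyy
        conv_lhs => arg 2; rw [hy]
        rw [inner_sub_left, hsymm, hAy, inner_smul_left, inner_smul_right, hconj, sub_self]
      rw [sub_eq_zero.1 hyy, one_apply_eq_self]
      module
  · set E : Submodule ℂ H := ((A - a • 1 : H →L[ℂ] H) : H →ₗ[ℂ] H).ker with hE
    have hmem : ∀ x, x ∈ E ↔ A x = a • x := fun x => by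
      rw [hE, LinearMap.mem_ker]
      simp [sub_eq_zero]
    have : CompleteSpace E := (ContinuousLinearMap.isClosed_ker (A - a • 1)).completeSpace_coe
    set P := E.starProjection with hP
    have hPP := isOrthoProj_starProjection E
    have hVV : (P + P - 1) * (P + P - 1) = 1 := by
      have : P * P = P := hPP.1
      simp only [mul_sub, sub_mul, mul_add, add_mul, this, mul_one, one_mul]
      abel
    have hVa : adjoint (P + P - 1) = P + P - 1 := by
      rw [map_sub, map_add, hPP.2, ← star_eq_adjoint, star_one]
    refine ⟨P + P - 1, (a - b) / 2, (a + b) / 2, div_ne_zero (sub_ne_zero.2 hab) two_ne_zero,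
      by rw [hVa, hVV], by rw [hVa, hVV], fun x hx => ?_⟩
    have hab' := sub_ne_zero.2 hab
    set v := (a - b)⁻¹ • (A x - b • x) with hv
    set w := (a - b)⁻¹ • (a • x - A x) with hw
    have hvw : x = v + w := by
      rw [hv, hw, ← smul_add, eq_inv_smul_iff₀ hab']
      module
    have hAv : A v = a • v := by
      rw [hv, map_smul, map_sub, map_smul, hx]
      module
    have hAw : A w = b • w := by
      rw [hw, map_smul, map_sub, map_smul, hx]
      module
    have hPx : P x = v := by
      rw [hvw, map_add, Submodule.starProjection_eq_self_iff.2 ((hmem v).2 hAv),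
        (Submodule.starProjection_apply_eq_zero_iff E).2
          fun y hy => horth hab ((hmem y).1 hy) hAw, add_zero]
    simp only [sub_apply, add_apply, one_apply_eq_self, hPx]
    clear_value v w
    conv_lhs => rw [hvw, map_add, hAv, hAw]
    conv_rhs => rw [hvw]
    module

theorem exists_unitary_of_eq_conj (hinf : ¬ FiniteDimensional ℂ H) {T : H →L[ℂ] H} (hT : HasCR T)
    {α γ : ℂ} {F : H →L[ℂ] H}
    (hF : α • (1 : H →L[ℂ] H) + conj γ • T + γ • adjoint T + adjoint T * T = F)
    (hrank : (F : H →ₗ[ℂ] H).rank < Cardinal.aleph0) :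
    ∃ (V L : H →L[ℂ] H) (l m : ℂ), adjoint V * V = 1 ∧ V * adjoint V = 1 ∧
      (L : H →ₗ[ℂ] H).rank ≤ (F : H →ₗ[ℂ] H).rank ∧ T = l • (V + L) + m • 1 := by
  set S := T + γ • (1 : H →L[ℂ] H) with hSdef
  have hSadj : adjoint S = adjoint T + conj γ • 1 := by
    rw [hSdef, map_add, map_smulₛₗ, ← star_eq_adjoint 1, star_one]
  have hSS : ∀ x, adjoint S (S x) = (γ * conj γ - α) • x + F x := fun x => by
    rw [hSadj, ← hF]
    simp only [hSdef, add_apply, smul_apply, mul_apply_eq_comp, one_apply_eq_self, map_add, map_smul]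
    module
  obtain ⟨x₀, hx₀, hFx₀⟩ := LinearMap.exists_ne_zero_of_rank_lt_aleph0 hinf hrank
  obtain ⟨r, hr0, hr⟩ : ∃ r : ℝ, 0 ≤ r ∧ γ * conj γ - α = (r : ℂ) := by
    refine ⟨‖S x₀‖ ^ 2 / ‖x₀‖ ^ 2, by positivity, ?_⟩
    have h := adjoint_inner_right S x₀ (S x₀)
    rw [hSS, show F x₀ = 0 from hFx₀, add_zero, inner_smul_right, inner_self_eq_norm_sq_to_K,
      inner_self_eq_norm_sq_to_K] at h
    have : (‖x₀‖ : ℂ) ≠ 0 := by simpa using hx₀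
    push_cast
    field_simp
    exact h
  have hker : ∀ v, S v = 0 ↔ adjoint S v = 0 := fun v => by
    have h := hT.apply_eq_smul_iff v (-γ)
    rw [hSadj, hSdef]
    simp only [add_apply, smul_apply, one_apply_eq_self]
    rw [add_eq_zero_iff_eq_neg, add_eq_zero_iff_eq_neg, ← neg_smul, ← neg_smul, h, map_neg]
  rcases hr0.eq_or_lt with rfl | hrpos
  · obtain ⟨L, hL, hTL⟩ := exists_eq_smul_add_of_ker (T := T) (V := 1) (l := 1) (m := -γ - 1)
      one_ne_zero (Φ := (F : H →ₗ[ℂ] H)) fun x hx => by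
        have hS0 : S x = 0 := by
          have h := adjoint_inner_right S x (S x)
          rw [hSS, hr, show F x = 0 from hx, Complex.ofReal_zero, zero_smul, add_zero,
            inner_zero_right] at h
          exact inner_self_eq_zero.1 h.symm
        have : T x = -(γ • x) := eq_neg_of_add_eq_zero_left hS0
        rw [this, one_apply_eq_self]
        module
    exact ⟨1, L, 1, -γ - 1, by rw [← star_eq_adjoint, star_one, one_mul],
      by rw [← star_eq_adjoint, star_one, one_mul], hL, hTL⟩
  · have hsqrt : (Real.sqrt r : ℂ) ≠ 0 := by
      exact_mod_cast (Real.sqrt_pos.2 hrpos).ne'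
    have hss : (Real.sqrt r : ℂ) * Real.sqrt r = r := by
      exact_mod_cast Real.mul_self_sqrt hr0
    have hrne : (r : ℂ) ≠ 0 := by exact_mod_cast hrpos.ne'
    have hadj : adjoint ((Real.sqrt r : ℂ)⁻¹ • S) = (Real.sqrt r : ℂ)⁻¹ • adjoint S := by
      rw [map_smulₛₗ, map_inv₀, Complex.conj_ofReal]
    obtain ⟨V, h1, h2, h3⟩ := exists_unitary_of_adjoint_mul_self_eq
      (S := (Real.sqrt r : ℂ)⁻¹ • S) (F := (r : ℂ)⁻¹ • F)
      (by
        ext x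
        rw [hadj]
        simp only [mul_apply_eq_comp, smul_apply, map_smul, hSS, hr, add_apply, one_apply_eq_self]
        rw [smul_smul, ← mul_inv, hss, smul_add, inv_smul_smul₀ hrne])
      ((LinearMap.rank_le_rank_of_ker_le fun x hx => by
        have : F x = 0 := hx
        simp [this]).trans_lt hrank)
      (fun v => by
        rw [hadj]
        simp only [smul_apply, smul_eq_zero, inv_eq_zero, hsqrt, false_or]
        exact hker v)
    obtain ⟨L, hL, hTL⟩ := exists_eq_smul_add_of_ker (T := T) (V := V) (m := -γ)
      hsqrt (Φ := (F : H →ₗ[ℂ] H)) fun x hx => by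
        have : F x = 0 := hx
        rw [h3 x (by rw [smul_apply, this, smul_zero]), smul_apply, smul_inv_smul₀ hsqrt, hSdef]
        simp
    exact ⟨V, L, _, _, h1, h2, hL, hTL⟩

theorem exists_unitary_of_ne_conj {T : H →L[ℂ] H} {α β γ : ℂ} (hβγ : β ≠ conj γ) {F : H →L[ℂ] H}
    (hF : α • (1 : H →L[ℂ] H) + β • T + γ • adjoint T + adjoint T * T = F)
    (hrank : (F : H →ₗ[ℂ] H).rank ≤ 3) :
    ∃ (V L : H →L[ℂ] H) (l m : ℂ), adjoint V * V = 1 ∧ V * adjoint V = 1 ∧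
      (L : H →ₗ[ℂ] H).rank ≤ 12 ∧ T = l • (V + L) + m • 1 := by
  set κ := β - conj γ with hκdef
  have hκ : κ ≠ 0 := sub_ne_zero.2 hβγ
  set c := α - conj α with hc
  have hFadj : (adjoint F : H →ₗ[ℂ] H).rank ≤ 3 :=
    (ContinuousLinearMap.rank_adjoint_le
      (hrank.trans_lt (by exact_mod_cast Cardinal.natCast_lt_aleph0 (n := 3)))).trans hrank
  have hFa : adjoint F =
      conj α • (1 : H →L[ℂ] H) + conj β • adjoint T + conj γ • T + adjoint T * T := by
    rw [← hF]
    simp only [map_add, map_smulₛₗ, ← star_eq_adjoint, star_mul, star_star,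
      star_one]
  have hdiff : ∀ x, F x - adjoint F x = κ • T x - conj κ • adjoint T x + c • x := fun x => by
    rw [hFa, ← hF]
    simp only [add_apply, smul_apply, one_apply_eq_self, hκdef, hc, map_sub, Complex.conj_conj]
    module
  set A := κ • T + conj κ • adjoint T with hAdef
  have hA : adjoint A = A := by
    rw [hAdef, map_add, map_smulₛₗ, map_smulₛₗ, adjoint_adjoint, Complex.conj_conj, add_comm]
  have hAx : ∀ x, F x - adjoint F x = 0 → A x = (2 * κ) • T x + c • x := fun x hx => by
    rw [hdiff] at hx
    rw [hAdef, add_apply, smul_apply, smul_apply, ← sub_eq_zero, ← neg_eq_zero, ← hx]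
    module
  set Φ : H →ₗ[ℂ] H × H × H := (F : H →ₗ[ℂ] H).prod ((adjoint F : H →ₗ[ℂ] H).prod
    (((F : H →ₗ[ℂ] H) - (adjoint F : H →ₗ[ℂ] H)) ∘ₗ (T : H →ₗ[ℂ] H))) with hΦ
  have hsub : ((F : H →ₗ[ℂ] H) - (adjoint F : H →ₗ[ℂ] H)).rank ≤ 3 + 3 := by
    have hneg : (-(adjoint F : H →ₗ[ℂ] H)).rank ≤ (adjoint F : H →ₗ[ℂ] H).rank :=
      LinearMap.rank_le_rank_of_ker_le fun x hx => by
        rw [LinearMap.mem_ker] at hx ⊢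
        rw [LinearMap.neg_apply, hx, neg_zero]
    rw [sub_eq_add_neg]
    exact (LinearMap.rank_add_le _ _).trans (add_le_add hrank (hneg.trans hFadj))
  have hΦrank : Φ.rank ≤ 12 := by
    refine (LinearMap.rank_prod_le _ _).trans ((add_le_add hrank
      ((LinearMap.rank_prod_le _ _).trans (add_le_add hFadj
        ((LinearMap.rank_comp_le_left _ _).trans hsub)))).trans_eq ?_)
    norm_num
  set s := -(c + conj κ * β + γ * κ) / κ with hs
  set t := -(conj κ * α + γ * c) / κ with ht
  have hTT : ∀ x, Φ x = 0 → F x - adjoint F x = 0 ∧ F (T x) - adjoint F (T x) = 0 ∧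
      T (T x) = s • T x + t • x := fun x hx => by
    have hx1 : F x = 0 := congrArg Prod.fst hx
    have hx2 : adjoint F x = 0 := congrArg (fun z => z.2.1) hx
    have hx3 : F (T x) - adjoint F (T x) = 0 := congrArg (fun z => z.2.2) hx
    have hx4 : F x - adjoint F x = 0 := by rw [hx1, hx2, sub_zero]
    refine ⟨hx4, hx3, ?_⟩
    rw [hdiff] at hx3 hx4
    rw [← hF] at hx1
    simp only [add_apply, smul_apply, mul_apply_eq_comp, one_apply_eq_self] at hx1
    have e1 : conj κ • adjoint T x = κ • T x + c • x := by
      rw [← sub_eq_zero, ← neg_eq_zero, ← hx4]; module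
    have e2 : conj κ • adjoint T (T x) = κ • T (T x) + c • T x := by
      rw [← sub_eq_zero, ← neg_eq_zero, ← hx3]; module
    have e3 : κ • T (T x) = (κ * s) • T x + (κ * t) • x := by
      rw [hs, ht, mul_div_cancel₀ _ hκ, mul_div_cancel₀ _ hκ]
      have e4 : conj κ • (α • x + β • T x) + γ • (conj κ • adjoint T x) +
          conj κ • adjoint T (T x) = 0 := by
        rw [← smul_zero (conj κ), ← hx1]; module
      rw [e1, e2] at e4
      rw [← sub_eq_zero, ← e4]
      module
    rw [← smul_right_injective H hκ |>.eq_iff]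
    simp only [e3]
    module
  set p := 2 * κ * s + 2 * c with hp
  set q := 4 * κ ^ 2 * t + c ^ 2 - p * c with hq
  obtain ⟨d, hd⟩ := IsAlgClosed.exists_pow_nat_eq (p ^ 2 + 4 * q) (n := 2) two_pos
  obtain ⟨V, l, m, hl, h1, h2, h3⟩ := exists_unitary_of_quadratic hA ((p + d) / 2) ((p - d) / 2)
  have hsum : (p + d) / 2 + (p - d) / 2 = p := by ring
  have hprod : (p + d) / 2 * ((p - d) / 2) = -q := by linear_combination -hd / 4
  rw [hsum, hprod] at h3
  have h2κ : 2 * κ ≠ 0 := mul_ne_zero two_ne_zero hκ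
  obtain ⟨L, hL, hTL⟩ := exists_eq_smul_add_of_ker (T := T) (V := V) (l := (2 * κ)⁻¹ * l)
    (m := (2 * κ)⁻¹ * (m - c)) (mul_ne_zero (inv_ne_zero h2κ) hl) (Φ := Φ) fun x hx => by
      obtain ⟨hx1, hx2, hx3⟩ := hTT x hx
      have hAAx : A (A x) = p • A x - (-q) • x := by
        rw [hAx x hx1, map_add, map_smul, map_smul, hAx x hx1, hAx _ hx2, hx3, hq, hp]
        module
      have h4 := h3 x hAAx
      rw [hAx x hx1] at h4
      rw [mul_smul, mul_smul, ← smul_add, eq_inv_smul_iff₀ h2κ, sub_smul, ← add_sub_assoc, ← h4,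
        add_sub_cancel_right]
  exact ⟨V, L, _, _, h1, h2, hL.trans hΦrank, hTL⟩

end Operators

theorem stmt15 {H : Type*} [NormedAddCommGroup H] [InnerProductSpace ℂ H]
    [CompleteSpace H] [TopologicalSpace.SeparableSpace H]
    (hinf : ¬ FiniteDimensional ℂ H) (T : H →L[ℂ] H) (hT : HasCR T)
    (α β γ δ : ℂ) (hδ : δ ≠ 0)
    (hrank : LinearMap.rank
      ((α • (1 : H →L[ℂ] H) + β • T + γ • ContinuousLinearMap.adjoint T +
        δ • (ContinuousLinearMap.adjoint T * T) : H →L[ℂ] H) : H →ₗ[ℂ] H) ≤ 3) :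
    ∃ (V L : H →L[ℂ] H) (fl mu : ℂ),
      ContinuousLinearMap.adjoint V * V = 1 ∧ V * ContinuousLinearMap.adjoint V = 1 ∧
      LinearMap.rank ((L : H →L[ℂ] H) : H →ₗ[ℂ] H) ≤ 12 ∧
      T = fl • (V + L) + mu • 1 := by
  have hF : (δ⁻¹ * α) • (1 : H →L[ℂ] H) + (δ⁻¹ * β) • T + (δ⁻¹ * γ) • adjoint T + adjoint T * T =
      δ⁻¹ • (α • (1 : H →L[ℂ] H) + β • T + γ • adjoint T + δ • (adjoint T * T)) := by
    simp only [smul_add, mul_smul, inv_smul_smul₀ hδ]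
  have hrank' := (LinearMap.rank_le_rank_of_ker_le (f := ((δ⁻¹ • (α • (1 : H →L[ℂ] H) + β • T +
    γ • adjoint T + δ • (adjoint T * T)) : H →L[ℂ] H) : H →ₗ[ℂ] H)) fun x hx => by
      rw [LinearMap.mem_ker, ContinuousLinearMap.coe_coe] at hx ⊢
      rw [smul_apply, hx, smul_zero]).trans hrank
  by_cases hβγ : δ⁻¹ * β = conj (δ⁻¹ * γ)
  · rw [hβγ] at hF
    obtain ⟨V, L, l, m, h1, h2, h3, h4⟩ := exists_unitary_of_eq_conj hinf hT hF
      (hrank'.trans_lt (by exact_mod_cast Cardinal.natCast_lt_aleph0 (n := 3)))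
    exact ⟨V, L, l, m, h1, h2, (h3.trans hrank').trans (by norm_num), h4⟩
  · exact exists_unitary_of_ne_conj hβγ hF hrank'
end
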